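/- Let θ(t)=t² for t≥0. A probability measure μ on ℝ satisfies Talagrand's inequality (there exists C<∞ such that T_θ(μ,ν) ≤ C·H(ν|μ) for every probability measure ν on ℝ) if and only if both of the following hold: μ satisfies the Poincaré inequality for smooth functions (there exists λ<∞ with Var_μ(f) ≤ λ ∫_ℝ |f′|² dμ for every smooth Lipschitz f:ℝ→ℝ), and μ satisfies the log-Sobolev inequality for convex functions, i.e. ∫_ℝ e^{s|x|} dμ(x)<∞ for every s>0 and there exists C′>0 with Ent_μ(e^φ) ≤ C′ ∫_ℝ |φ′|² e^φ dμ for every smooth convex Lipschitz φ:ℝ→ℝ. -/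

import Mathlib

open MeasureTheory ProbabilityTheory Real Set Filter Topology
open scoped ENNReal NNReal

/-- The generalized inverse `F_μ^{-1}(t) = inf {y : F_μ(y) ≥ t}` of the cumulative
distribution function `F_μ(y) = μ((-∞, y])`. -/
noncomputable def invCDF (μ : Measure ℝ) (t : ℝ) : ℝ :=
  sInf {y : ℝ | t ≤ (μ (Iic y)).toReal}

/-- The cumulative distribution function of the symmetric exponential measure `τ`
with density `(1/2) e^{-|x|}`. -/
noncomputable def expCDF (x : ℝ) : ℝ :=
  if x < 0 then Real.exp x / 2 else 1 - Real.exp (-x) / 2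

/-- `U_μ = F_μ^{-1} ∘ F_τ`, the unique left-continuous non-decreasing map
transporting `τ` onto `μ`. -/
noncomputable def Umap (μ : Measure ℝ) (x : ℝ) : ℝ :=
  invCDF μ (expCDF x)

open scoped Classical in
/-- `Ent_μ(g) = ∫ g ln g dμ − (∫ g dμ) ln (∫ g dμ)` if `∫ g ln g dμ < ∞`, and `+∞`
otherwise (for nonnegative `g` this quantity is nonnegative, so it is recorded in `ℝ≥0∞`). -/
noncomputable def Ent (μ : Measure ℝ) (g : ℝ → ℝ) : ℝ≥0∞ :=
  if Integrable (fun x => g x * Real.log (g x)) μ then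
    ENNReal.ofReal ((∫ x, g x * Real.log (g x) ∂μ) -
      (∫ x, g x ∂μ) * Real.log (∫ x, g x ∂μ))
  else ⊤

open scoped Classical in
/-- The relative entropy `H(ν|μ) = ∫ log (dν/dμ) dν`, `+∞` if `ν` is not absolutely
continuous w.r.t. `μ` (for probability measures it is nonnegative, hence valued in `ℝ≥0∞`). -/
noncomputable def relEnt {α : Type*} [MeasurableSpace α] (ν μ : Measure α) : ℝ≥0∞ :=
  if ν ≪ μ ∧ Integrable (fun x => Real.log ((ν.rnDeriv μ x).toReal)) ν then
    ENNReal.ofReal (∫ x, Real.log ((ν.rnDeriv μ x).toReal) ∂ν)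
  else ⊤

/-- The weak (barycentric) transport cost
`T̄_θ(μ₂|μ₁) = inf_π ∫ θ(|x − ∫ y p(x,dy)|) μ₁(dx)`, the infimum running over all
couplings `π(dxdy) = p(x,dy) μ₁(dx)` of `μ₁` and `μ₂` (described by their
disintegration kernels `p`). -/
noncomputable def weakCost (θ : ℝ → ℝ) (μ₂ μ₁ : Measure ℝ) : ℝ≥0∞ :=
  ⨅ (p : Kernel ℝ ℝ) (_ : IsMarkovKernel p) (_ : μ₁.bind (fun x => p x) = μ₂),
    ∫⁻ x, ENNReal.ofReal (θ |x - ∫ y, y ∂(p x)|) ∂μ₁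

/-- `μ` satisfies `T̄⁻(θ)`: `T̄_θ(μ|ν) ≤ H(ν|μ)` for every probability measure `ν`
with finite first moment. -/
def Tminus (θ : ℝ → ℝ) (μ : Measure ℝ) : Prop :=
  ∀ ν : Measure ℝ, IsProbabilityMeasure ν → Integrable (fun x => x) ν →
    weakCost θ μ ν ≤ relEnt ν μ

/-- `μ` satisfies `T̄⁺(θ)`: `T̄_θ(ν|μ) ≤ H(ν|μ)` for every probability measure `ν`
with finite first moment. -/
def Tplus (θ : ℝ → ℝ) (μ : Measure ℝ) : Prop :=
  ∀ ν : Measure ℝ, IsProbabilityMeasure ν → Integrable (fun x => x) ν →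
    weakCost θ ν μ ≤ relEnt ν μ

/-- The inverse of an increasing cost function `θ` on `[0,∞)`:
`θ⁻¹(u) = inf {t ≥ 0 : θ(t) ≥ u}`. -/
noncomputable def cinv (θ : ℝ → ℝ) (u : ℝ) : ℝ :=
  sInf {t : ℝ | 0 ≤ t ∧ u ≤ θ t}

/-- The classical (Monge–Kantorovich) transport cost
`T_θ(μ,ν) = inf_π ∫ θ(|x − y|) dπ(x,y)`, the infimum running over all couplings `π` of `μ`
and `ν`. -/
noncomputable def transportCost (θ : ℝ → ℝ) (μ ν : Measure ℝ) : ℝ≥0∞ :=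
  ⨅ (γ : Measure (ℝ × ℝ)) (_ : γ.map Prod.fst = μ) (_ : γ.map Prod.snd = ν),
    ∫⁻ p, ENNReal.ofReal (θ |p.1 - p.2|) ∂γ

section PartPA

lemma relEnt_tilted (μ : Measure ℝ) [IsProbabilityMeasure μ] (φ : ℝ → ℝ)
    (h1 : Integrable (fun x => exp (φ x)) μ) (h2 : Integrable φ (μ.tilted φ)) :
    relEnt (μ.tilted φ) μ =
      ENNReal.ofReal ((∫ x, φ x ∂(μ.tilted φ)) - log (∫ x, exp (φ x) ∂μ)) ∧
    0 ≤ (∫ x, φ x ∂(μ.tilted φ)) - log (∫ x, exp (φ x) ∂μ) := by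
  have hp : IsProbabilityMeasure (μ.tilted φ) := isProbabilityMeasure_tilted h1
  have hac : μ.tilted φ ≪ μ := tilted_absolutelyContinuous μ φ
  have hlog := hac.ae_le (log_rnDeriv_tilted_left_self h1)
  have hintegr : Integrable (fun x => Real.log (((μ.tilted φ).rnDeriv μ x).toReal)) (μ.tilted φ) := by
    refine (integrable_congr hlog).2 ?_
    exact h2.sub (integrable_const _)
  have hval : ∫ x, Real.log (((μ.tilted φ).rnDeriv μ x).toReal) ∂(μ.tilted φ)
      = (∫ x, φ x ∂(μ.tilted φ)) - log (∫ x, exp (φ x) ∂μ) := by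
    rw [integral_congr_ae hlog, integral_sub h2 (integrable_const _)]
    simp
  constructor
  · unfold relEnt
    rw [if_pos ⟨hac, hintegr⟩, hval]
  · have := InformationTheory.integral_llr_add_sub_measure_univ_nonneg hac hintegr
    simp only [llr_def] at this
    rw [hval] at this
    simpa using this

lemma exists_coupling (μ : Measure ℝ) [IsProbabilityMeasure μ] (C : ℝ) (hC : 0 < C)
    (hT : ∀ ν : Measure ℝ, IsProbabilityMeasure ν →
      transportCost (fun t => t ^ 2) μ ν ≤ ENNReal.ofReal C * relEnt ν μ)
    (ν : Measure ℝ) [IsProbabilityMeasure ν] (h : ℝ) (hh : relEnt ν μ = ENNReal.ofReal h)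
    (h0 : 0 ≤ h) (ε : ℝ) (hε : 0 < ε) :
    ∃ κ : Measure (ℝ × ℝ), IsProbabilityMeasure κ ∧ κ.map Prod.fst = μ ∧ κ.map Prod.snd = ν ∧
      Integrable (fun p : ℝ × ℝ => (p.1 - p.2) ^ 2) κ ∧
      ∫ p, (p.1 - p.2) ^ 2 ∂κ ≤ C * h + ε := by
  have h1 := hT ν inferInstance
  rw [hh, ← ENNReal.ofReal_mul hC.le] at h1
  have h2 : transportCost (fun t => t ^ 2) μ ν < ENNReal.ofReal (C * h + ε) :=
    lt_of_le_of_lt h1 ((ENNReal.ofReal_lt_ofReal_iff (by positivity)).2 (by linarith))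
  unfold transportCost at h2
  simp only [iInf_lt_iff] at h2
  obtain ⟨κ, hκ1, hκ2, h3⟩ := h2
  have hpr : IsProbabilityMeasure κ := by
    have : IsProbabilityMeasure (κ.map Prod.fst) := hκ1 ▸ inferInstance
    constructor
    have h5 : (κ.map Prod.fst) univ = 1 := measure_univ
    rwa [Measure.map_apply measurable_fst MeasurableSet.univ, preimage_univ] at h5
  have h4 : ∫⁻ p, ENNReal.ofReal ((p.1 - p.2) ^ 2) ∂κ < ENNReal.ofReal (C * h + ε) := by
    simpa [sq_abs] using h3
  have hi : Integrable (fun p : ℝ × ℝ => (p.1 - p.2) ^ 2) κ := by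
    refine ⟨by fun_prop, ?_⟩
    rw [hasFiniteIntegral_iff_ofReal (ae_of_all _ fun p => sq_nonneg _)]
    exact h4.trans ENNReal.ofReal_lt_top
  refine ⟨κ, hpr, hκ1, hκ2, hi, ?_⟩
  rw [integral_eq_lintegral_of_nonneg_ae (ae_of_all _ fun p => sq_nonneg _) (by fun_prop)]
  refine ENNReal.toReal_le_of_le_ofReal (by positivity) h4.le

lemma integrable_fst_of {κ : Measure (ℝ × ℝ)} {μ : Measure ℝ} (h : κ.map Prod.fst = μ)
    {f : ℝ → ℝ} (hf : Integrable f μ) : Integrable (fun p => f p.1) κ ∧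
      ∫ p, f p.1 ∂κ = ∫ x, f x ∂μ := by
  subst h
  exact ⟨hf.comp_measurable measurable_fst,
    (integral_map measurable_fst.aemeasurable hf.aestronglyMeasurable).symm⟩

lemma integrable_snd_of {κ : Measure (ℝ × ℝ)} {μ : Measure ℝ} (h : κ.map Prod.snd = μ)
    {f : ℝ → ℝ} (hf : Integrable f μ) : Integrable (fun p => f p.2) κ ∧
      ∫ p, f p.2 ∂κ = ∫ x, f x ∂μ := by
  subst h
  exact ⟨hf.comp_measurable measurable_snd,
    (integral_map measurable_snd.aemeasurable hf.aestronglyMeasurable).symm⟩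

/-- Jensen: `∫ φ ≤ log ∫ exp φ`. -/
lemma integral_le_log_integral_exp (μ : Measure ℝ) [IsProbabilityMeasure μ] (φ : ℝ → ℝ)
    (h0 : Integrable φ μ) (h1 : Integrable (fun x => exp (φ x)) μ) :
    ∫ x, φ x ∂μ ≤ log (∫ x, exp (φ x) ∂μ) := by
  have h := convexOn_exp.map_integral_le (μ := μ) (f := φ) continuous_exp.continuousOn isClosed_univ
    (by simp) h0 h1
  rw [← Real.log_exp (∫ x, φ x ∂μ)]
  exact Real.log_le_log (exp_pos _) h

/-- Key bound: a one-sided pointwise estimate yields an estimate on tilted measures. -/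
lemma tilted_bound (μ : Measure ℝ) [IsProbabilityMeasure μ] (C : ℝ) (hC : 0 < C)
    (hT : ∀ ν : Measure ℝ, IsProbabilityMeasure ν →
      transportCost (fun t => t ^ 2) μ ν ≤ ENNReal.ofReal C * relEnt ν μ)
    (φ : ℝ → ℝ) (h0 : Integrable φ μ)
    (h1 : Integrable (fun x => exp (φ x)) μ) (h2 : Integrable φ (μ.tilted φ))
    (A B : ℝ → ℝ) (K : ℝ) (hA : Integrable A μ) (hB : Integrable B (μ.tilted φ)) (hK : 0 ≤ K)
    (hφ : ∀ x y, φ y - φ x ≤ A x + B y + K * (x - y) ^ 2) :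
    (∫ y, φ y ∂(μ.tilted φ)) - ∫ x, φ x ∂μ ≤ (∫ x, A x ∂μ) + (∫ y, B y ∂(μ.tilted φ)) +
      K * (C * ((∫ y, φ y ∂(μ.tilted φ)) - log (∫ x, exp (φ x) ∂μ))) := by
  have hp : IsProbabilityMeasure (μ.tilted φ) := isProbabilityMeasure_tilted h1
  obtain ⟨e1, e2⟩ := relEnt_tilted μ φ h1 h2
  set h := (∫ y, φ y ∂(μ.tilted φ)) - log (∫ x, exp (φ x) ∂μ) with hh
  refine le_of_forall_pos_le_add fun ε hε => ?_
  obtain ⟨κ, _, hκ1, hκ2, hi, hle⟩ := exists_coupling μ C hC hT _ h e1 e2 (ε / (K + 1)) (by positivity)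
  obtain ⟨i1, v1⟩ := integrable_fst_of hκ1 h0
  obtain ⟨i2, v2⟩ := integrable_snd_of hκ2 h2
  obtain ⟨i3, v3⟩ := integrable_fst_of hκ1 hA
  obtain ⟨i4, v4⟩ := integrable_snd_of hκ2 hB
  have i34 : Integrable (fun p : ℝ × ℝ => A p.1 + B p.2) κ := i3.add i4
  have this : ∫ p, (φ p.2 - φ p.1) ∂κ ≤ ∫ p, ((A p.1 + B p.2) + K * (p.1 - p.2) ^ 2) ∂κ :=
    integral_mono (i2.sub i1) (i34.add (hi.const_mul K)) (fun p => hφ p.1 p.2)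
  rw [integral_sub i2 i1, integral_add i34 (hi.const_mul K),
    integral_add i3 i4, integral_const_mul, v1, v2, v3, v4] at this
  have h5 : K * ∫ p, (p.1 - p.2) ^ 2 ∂κ ≤ K * (C * h + ε / (K + 1)) :=
    mul_le_mul_of_nonneg_left hle hK
  have h6 : K * (ε / (K + 1)) ≤ ε := by
    rw [mul_div_assoc', div_le_iff₀ (by positivity)]; nlinarith
  nlinarith

lemma sq_integrable_of_T2 (μ : Measure ℝ) [IsProbabilityMeasure μ] (C : ℝ) (hC : 0 < C)
    (hT : ∀ ν : Measure ℝ, IsProbabilityMeasure ν →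
      transportCost (fun t => t ^ 2) μ ν ≤ ENNReal.ofReal C * relEnt ν μ) :
    Integrable (fun x : ℝ => x ^ 2) μ := by
  set φ : ℝ → ℝ := fun x => -x ^ 2 with hφ
  have hb : ∀ x : ℝ, exp (φ x) ≤ 1 := fun x => exp_le_one_iff.2 (by simp [hφ]; positivity)
  have h1 : Integrable (fun x => exp (φ x)) μ := by
    refine Integrable.of_bound (C := 1) (by simp only [hφ]; fun_prop) (ae_of_all _ fun x => ?_)
    rw [norm_eq_abs, abs_exp]; exact hb x
  have h2 : Integrable φ (μ.tilted φ) := by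
    rw [integrable_tilted_iff h1]
    refine Integrable.of_bound (C := 1) (by simp only [hφ]; fun_prop) (ae_of_all _ fun x => ?_)
    simp only [hφ, smul_eq_mul, norm_mul, norm_eq_abs, abs_exp, abs_neg]
    rw [abs_of_nonneg (by positivity), Real.exp_neg, inv_mul_le_iff₀ (exp_pos _)]
    have := Real.add_one_le_exp (x ^ 2)
    linarith
  have hp : IsProbabilityMeasure (μ.tilted φ) := isProbabilityMeasure_tilted h1
  obtain ⟨e1, e2⟩ := relEnt_tilted μ φ h1 h2
  obtain ⟨κ, _, hκ1, hκ2, hi, hle⟩ := exists_coupling μ C hC hT _ _ e1 e2 1 one_pos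
  obtain ⟨i2, v2⟩ := integrable_snd_of hκ2 h2
  have h3 : Integrable (fun p : ℝ × ℝ => p.1 ^ 2) κ := by
    refine Integrable.mono' ((hi.const_mul 2).sub (i2.const_mul 2)) (by fun_prop)
      (ae_of_all _ fun p => ?_)
    simp only [Pi.sub_apply, hφ, norm_eq_abs]
    rw [abs_of_nonneg (sq_nonneg _)]
    nlinarith [sq_nonneg (p.1 - 2 * p.2)]
  rw [← hκ1]
  exact (integrable_map_measure (by fun_prop) measurable_fst.aemeasurable).2 h3

lemma exp_integrable_of_T2 (μ : Measure ℝ) [IsProbabilityMeasure μ] (C : ℝ) (hC : 0 < C)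
    (hT : ∀ ν : Measure ℝ, IsProbabilityMeasure ν →
      transportCost (fun t => t ^ 2) μ ν ≤ ENNReal.ofReal C * relEnt ν μ) (s : ℝ) (hs : 0 < s) :
    Integrable (fun x => exp (s * |x|)) μ := by
  have hx2 := sq_integrable_of_T2 μ C hC hT
  have hx1 : Integrable (fun x : ℝ => |x|) μ := by
    refine Integrable.mono' ((integrable_const (1:ℝ)).add hx2) (by fun_prop) (ae_of_all _ fun x => ?_)
    simp only [Pi.add_apply, norm_eq_abs, abs_abs]
    nlinarith [sq_nonneg (|x| - 1), sq_abs x]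
  have key : ∀ N : ℕ, ∫⁻ x, ENNReal.ofReal (exp (s * min |x| N)) ∂μ ≤
      ENNReal.ofReal (exp (s * (∫ x, |x| ∂μ) + s ^ 2 * C)) := by
    intro N
    set φ : ℝ → ℝ := fun x => s * min |x| N with hφ
    have hc : Continuous φ := by simp only [hφ]; fun_prop
    have hb : ∀ x, |φ x| ≤ s * N := fun x => by
      have : 0 ≤ min |x| (N:ℝ) := le_min (abs_nonneg _) (Nat.cast_nonneg _)
      simp only [hφ]
      rw [abs_of_nonneg (by positivity)]
      exact mul_le_mul_of_nonneg_left (min_le_right _ _) hs.le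
    have h0 : Integrable φ μ := Integrable.of_bound hc.aestronglyMeasurable (s * N) (ae_of_all _ hb)
    have h1 : Integrable (fun x => exp (φ x)) μ := by
      refine Integrable.of_bound (C := exp (s * N)) (by fun_prop) (ae_of_all _ fun x => ?_)
      rw [norm_eq_abs, abs_exp]; exact exp_le_exp.2 ((le_abs_self _).trans (hb x))
    have hp : IsProbabilityMeasure (μ.tilted φ) := isProbabilityMeasure_tilted h1
    have h2 : Integrable φ (μ.tilted φ) :=
      Integrable.of_bound hc.aestronglyMeasurable (s * N) (ae_of_all _ hb)
    have hlip : ∀ x y : ℝ, φ y - φ x ≤ s ^ 2 * C / 2 + 0 + (1 / (2 * C)) * (x - y) ^ 2 := by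
      intro x y
      have a1 : min |y| (N:ℝ) - min |x| N ≤ |x - y| := by
        have := abs_min_sub_min_le_max |y| (N:ℝ) |x| N
        simp only [sub_self, abs_zero] at this
        have h3 := abs_abs_sub_abs_le y x
        rw [abs_sub_comm y x] at h3
        have h4 : max |(|y| - |x|)| 0 ≤ |x - y| := max_le h3 (abs_nonneg _)
        exact (le_abs_self _).trans (this.trans h4)
      have a2 : φ y - φ x ≤ s * |x - y| := by
        simp only [hφ]; rw [← mul_sub]; exact mul_le_mul_of_nonneg_left a1 hs.le
      have a3 : s ^ 2 * C / 2 + 0 + (1 / (2 * C)) * (x - y) ^ 2 - s * |x - y|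
          = (s * C - |x - y|) ^ 2 / (2 * C) := by
        field_simp; rw [← sq_abs (x - y)]; ring
      have : 0 ≤ (s * C - |x - y|) ^ 2 / (2 * C) := by positivity
      linarith
    have hb := tilted_bound μ C hC hT φ h0 h1 h2 (fun _ => s ^ 2 * C / 2) (fun _ => 0) (1 / (2 * C))
      (integrable_const _) (integrable_const _) (by positivity) hlip
    have hj := integral_le_log_integral_exp μ φ h0 h1
    obtain ⟨e1, e2⟩ := relEnt_tilted μ φ h1 h2
    simp only [integral_const, probReal_univ, smul_eq_mul, one_mul] at hb
    have e3 : 1 / (2 * C) * (C * ((∫ y, φ y ∂(μ.tilted φ)) - log (∫ x, exp (φ x) ∂μ)))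
      = ((∫ y, φ y ∂(μ.tilted φ)) - log (∫ x, exp (φ x) ∂μ)) / 2 := by field_simp
    rw [e3] at hb
    have h5 : ∫ x, φ x ∂μ ≤ s * ∫ x, |x| ∂μ := by
      rw [← integral_const_mul]
      exact integral_mono h0 (hx1.const_mul s) fun x =>
        mul_le_mul_of_nonneg_left (min_le_left _ _) hs.le
    have h6 : log (∫ x, exp (φ x) ∂μ) ≤ s * (∫ x, |x| ∂μ) + s ^ 2 * C := by linarith
    rw [← ofReal_integral_eq_lintegral_ofReal h1 (ae_of_all _ fun x => (exp_pos _).le)]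
    refine ENNReal.ofReal_le_ofReal ?_
    have hpos : 0 < ∫ x, exp (φ x) ∂μ := integral_exp_pos h1
    exact (log_le_iff_le_exp hpos).1 h6
  refine ⟨by fun_prop, ?_⟩
  rw [hasFiniteIntegral_iff_ofReal (ae_of_all _ fun x => (exp_pos _).le)]
  have hfat : ∫⁻ x, ENNReal.ofReal (exp (s * |x|)) ∂μ ≤
      liminf (fun N : ℕ => ∫⁻ x, ENNReal.ofReal (exp (s * min |x| N)) ∂μ) atTop := by
    have : ∀ x : ℝ, ENNReal.ofReal (exp (s * |x|)) ≤
        liminf (fun N : ℕ => ENNReal.ofReal (exp (s * min |x| N))) atTop := by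
      intro x
      refine le_of_eq (Tendsto.liminf_eq ?_).symm
      refine tendsto_const_nhds.congr' ?_
      filter_upwards [eventually_ge_atTop ⌈|x|⌉₊] with N hN
      rw [min_eq_left ((Nat.le_ceil _).trans (by exact_mod_cast hN))]
    refine (lintegral_mono this).trans (lintegral_liminf_le fun N => by fun_prop)
  refine lt_of_le_of_lt (hfat.trans ?_) (ENNReal.ofReal_lt_top (r := exp (s * (∫ x, |x| ∂μ) + s ^ 2 * C)))
  exact liminf_le_of_le (by isBoundedDefault) fun b hb => by
    obtain ⟨n, hn⟩ := hb.exists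
    exact hn.trans (key n)

end PartPA

section PartPB

lemma expbound_integrable (μ : Measure ℝ)
    (hexp : ∀ s > (0:ℝ), Integrable (fun x => Real.exp (s * |x|)) μ) {g : ℝ → ℝ}
    (hg : AEStronglyMeasurable g μ) {A B : ℝ} (hB : 0 < B) (h : ∀ x, |g x| ≤ A * exp (B * |x|)) :
    Integrable g μ :=
  ((hexp B hB).const_mul A).mono' hg (ae_of_all _ h)

lemma lip_abs_le {f : ℝ → ℝ} {K : ℝ≥0} (hf : LipschitzWith K f) (x : ℝ) :
    |f x| ≤ |f 0| + K * |x| := by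
  have h := hf.dist_le_mul x 0
  rw [Real.dist_eq, Real.dist_eq, sub_zero] at h
  have := abs_sub_abs_le_abs_sub (f x) (f 0)
  linarith

lemma lip_exp_bound {f : ℝ → ℝ} {K : ℝ≥0} (hf : LipschitzWith K f) (x : ℝ) :
    exp (f x) ≤ exp (|f 0|) * exp ((K + 1) * |x|) := by
  rw [← exp_add]
  refine exp_le_exp.2 ((le_abs_self _).trans ((lip_abs_le hf x).trans ?_))
  nlinarith [abs_nonneg x]

lemma lip_lin_bound {f : ℝ → ℝ} {K : ℝ≥0} (hf : LipschitzWith K f) (x : ℝ) :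
    |f x| ≤ exp (|f 0|) * exp ((K + 1) * |x|) := by
  rw [← exp_add]
  have := Real.add_one_le_exp (|f 0| + (K + 1) * |x|)
  have := lip_abs_le hf x
  nlinarith [abs_nonneg x]

lemma lip_sq_bound {f : ℝ → ℝ} {K : ℝ≥0} (hf : LipschitzWith K f) (x : ℝ) :
    |f x ^ 2| ≤ (exp (|f 0|)) ^ 2 * exp ((2 * (K + 1)) * |x|) := by
  rw [abs_pow]
  have h1 := lip_lin_bound hf x
  have : (exp (|f 0|)) ^ 2 * exp ((2 * (K + 1)) * |x|) = (exp (|f 0|) * exp ((K + 1) * |x|)) ^ 2 := by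
    rw [mul_pow, ← Real.exp_nat_mul ((K + 1) * |x|)]; push_cast; ring_nf
  rw [this]
  exact pow_le_pow_left₀ (abs_nonneg _) h1 2


lemma lip_integrable {μ : Measure ℝ}
    (hexp : ∀ s > (0:ℝ), Integrable (fun x => Real.exp (s * |x|)) μ) {f : ℝ → ℝ} {K : ℝ≥0}
    (hf : LipschitzWith K f) : Integrable f μ :=
  expbound_integrable μ hexp hf.continuous.aestronglyMeasurable (by positivity) (lip_lin_bound hf)

lemma lip_sq_integrable {μ : Measure ℝ}
    (hexp : ∀ s > (0:ℝ), Integrable (fun x => Real.exp (s * |x|)) μ) {f : ℝ → ℝ} {K : ℝ≥0}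
    (hf : LipschitzWith K f) : Integrable (fun x => f x ^ 2) μ :=
  expbound_integrable μ hexp (hf.continuous.pow 2).aestronglyMeasurable (by positivity)
    (lip_sq_bound hf)

lemma lip_exp_integrable {μ : Measure ℝ}
    (hexp : ∀ s > (0:ℝ), Integrable (fun x => Real.exp (s * |x|)) μ) {f : ℝ → ℝ} {K : ℝ≥0}
    (hf : LipschitzWith K f) : Integrable (fun x => exp (f x)) μ :=
  expbound_integrable μ hexp (by have := hf.continuous; fun_prop) (B := K + 1) (by positivity)
    (fun x => by rw [abs_exp]; exact lip_exp_bound hf x)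

lemma lip_mul_exp_integrable {μ : Measure ℝ}
    (hexp : ∀ s > (0:ℝ), Integrable (fun x => Real.exp (s * |x|)) μ) {f : ℝ → ℝ} {K : ℝ≥0}
    (hf : LipschitzWith K f) : Integrable (fun x => exp (f x) * f x) μ := by
  refine expbound_integrable μ hexp (A := exp (|f 0|) ^ 2) (by have := hf.continuous; fun_prop) (B := 2 * (K + 1)) (by positivity)
    (fun x => ?_)
  rw [abs_mul, abs_exp]
  have : (exp (|f 0|)) ^ 2 * exp ((2 * (K + 1)) * |x|) = (exp (|f 0|) * exp ((K + 1) * |x|)) * (exp (|f 0|) * exp ((K + 1) * |x|)) := by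
    rw [← sq, mul_pow, ← Real.exp_nat_mul ((K + 1) * |x|)]; push_cast; ring_nf
  rw [this]
  exact mul_le_mul (lip_exp_bound hf x) (lip_lin_bound hf x) (abs_nonneg _) (by positivity)

lemma lip_integrable_tilted {μ : Measure ℝ}
    (hexp : ∀ s > (0:ℝ), Integrable (fun x => Real.exp (s * |x|)) μ) {f : ℝ → ℝ} {K : ℝ≥0}
    (hf : LipschitzWith K f) : Integrable f (μ.tilted f) := by
  rw [integrable_tilted_iff (lip_exp_integrable hexp hf)]
  exact lip_mul_exp_integrable hexp hf

lemma convex_LSI_of_T2 (μ : Measure ℝ) [IsProbabilityMeasure μ] (C : ℝ) (hC : 0 < C)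
    (hT : ∀ ν : Measure ℝ, IsProbabilityMeasure ν →
      transportCost (fun t => t ^ 2) μ ν ≤ ENNReal.ofReal C * relEnt ν μ)
    (φ : ℝ → ℝ) (hs : ContDiff ℝ (⊤ : ℕ∞) φ) (hc : ConvexOn ℝ Set.univ φ)
    (K : ℝ≥0) (hK : LipschitzWith K φ) :
    Ent μ (fun x => Real.exp (φ x)) ≤ ENNReal.ofReal C *
              ∫⁻ x, ENNReal.ofReal ((deriv φ x) ^ 2 * Real.exp (φ x)) ∂μ := by
  have hexp := exp_integrable_of_T2 μ C hC hT
  have i0 := lip_integrable hexp hK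
  have i1 := lip_exp_integrable hexp hK
  have i2 := lip_integrable_tilted hexp hK
  have i3 := lip_mul_exp_integrable hexp hK
  have hp : IsProbabilityMeasure (μ.tilted φ) := isProbabilityMeasure_tilted i1
  have hdc : Continuous (deriv φ) := hs.continuous_deriv (by simp)
  have hdb : ∀ x, |deriv φ x| ≤ K := fun x => norm_deriv_le_of_lipschitz hK
  have hdb2 : ∀ x, |deriv φ x ^ 2| ≤ K ^ 2 := fun x => by
    rw [abs_pow]; exact pow_le_pow_left₀ (abs_nonneg _) (hdb x) 2
  have i4 : Integrable (fun x => deriv φ x ^ 2) (μ.tilted φ) :=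
    Integrable.of_bound (hdc.pow 2).aestronglyMeasurable (K ^ 2) (ae_of_all _ hdb2)
  have hpt : ∀ x y, φ y - φ x ≤ 0 + C / 2 * deriv φ y ^ 2 + 1 / (2 * C) * (x - y) ^ 2 := by
    intro x y
    have hd : DifferentiableAt ℝ φ y := (hs.differentiable (by simp)) y
    have h1 : φ y - φ x ≤ deriv φ y * (y - x) := by
      rcases lt_trichotomy x y with h | h | h
      · have := hc.slope_le_of_hasDerivAt (mem_univ x) (mem_univ y) h hd.hasDerivAt
        rw [slope_def_field, div_le_iff₀ (by linarith)] at this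
        exact this
      · simp [h]
      · have := hc.le_slope_of_hasDerivAt (mem_univ y) (mem_univ x) h hd.hasDerivAt
        rw [slope_def_field, le_div_iff₀ (by linarith)] at this
        linarith
    have h2 : 0 ≤ (C * deriv φ y - (y - x)) ^ 2 / (2 * C) := by positivity
    have h3 : (C * deriv φ y - (y - x)) ^ 2 / (2 * C) = C / 2 * deriv φ y ^ 2 + 1 / (2 * C) * (x - y) ^ 2 - deriv φ y * (y - x) := by
      field_simp; ring
    linarith
  have hb := tilted_bound μ C hC hT φ i0 i1 i2 (fun _ => 0) (fun y => C / 2 * deriv φ y ^ 2) (1 / (2 * C))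
    (integrable_const _) (i4.const_mul _) (by positivity) hpt
  have hj := integral_le_log_integral_exp μ φ i0 i1
  rw [integral_const_mul] at hb
  simp only [integral_const, probReal_univ, smul_eq_mul, mul_zero] at hb
  have e3 : 1 / (2 * C) * (C * ((∫ y, φ y ∂(μ.tilted φ)) - log (∫ x, exp (φ x) ∂μ)))
      = ((∫ y, φ y ∂(μ.tilted φ)) - log (∫ x, exp (φ x) ∂μ)) / 2 := by field_simp
  rw [e3] at hb
  have hH : (∫ y, φ y ∂(μ.tilted φ)) - log (∫ x, exp (φ x) ∂μ) ≤ C * ∫ y, deriv φ y ^ 2 ∂(μ.tilted φ) := by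
    linarith
  have hpos : 0 < ∫ x, exp (φ x) ∂μ := integral_exp_pos i1
  have i5 : Integrable (fun x => deriv φ x ^ 2 * exp (φ x)) μ := by
    have := (integrable_tilted_iff i1 _).1 i4
    simpa [mul_comm] using this
  have v1 : ∫ x, exp (φ x) * φ x ∂μ = (∫ x, exp (φ x) ∂μ) * ∫ y, φ y ∂(μ.tilted φ) := by
    rw [integral_tilted, ← integral_const_mul]
    refine integral_congr_ae (ae_of_all _ fun x => ?_)
    simp only [smul_eq_mul]; field_simp
  have v2 : ∫ x, deriv φ x ^ 2 * exp (φ x) ∂μ = (∫ x, exp (φ x) ∂μ) * ∫ y, deriv φ y ^ 2 ∂(μ.tilted φ) := by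
    rw [integral_tilted, ← integral_const_mul]
    refine integral_congr_ae (ae_of_all _ fun x => ?_)
    simp only [smul_eq_mul]; field_simp
  unfold Ent
  have i3' : Integrable (fun x => exp (φ x) * log (exp (φ x))) μ := by simpa only [Real.log_exp] using i3
  rw [if_pos i3']
  simp only [Real.log_exp]
  rw [ ← ofReal_integral_eq_lintegral_ofReal i5 (ae_of_all _ fun x => by positivity),
    ← ENNReal.ofReal_mul hC.le, v1, v2]
  refine ENNReal.ofReal_le_ofReal ?_
  have := mul_le_mul_of_nonneg_left hH hpos.le
  linarith

lemma taylor_loc {f : ℝ → ℝ} (hs : ContDiff ℝ (⊤ : ℕ∞) f) (R : ℝ) :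
    ∃ M : ℝ, 0 ≤ M ∧ ∀ x y, |x| ≤ R → |x - y| ≤ 1 → f y - f x ≤ |deriv f x| * |x - y| + M * |x - y| ^ 2 := by
  have hs1 : ContDiff ℝ (⊤ : ℕ∞) (deriv f) := by
    have := (contDiff_infty_iff_deriv (𝕜 := ℝ) (f := f)).1 hs
    exact this.2
  have hc2 : Continuous (deriv (deriv f)) := hs1.continuous_deriv (by simp)
  obtain ⟨M, hM⟩ := (isCompact_Icc (a := -(R + 1)) (b := R + 1)).exists_bound_of_continuousOn hc2.continuousOn
  have hd := hs.differentiable (by simp)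
  have hd1 := hs1.differentiable (by simp)
  refine ⟨max M 0, le_max_right _ _, fun x y hx hxy => ?_⟩
  rw [abs_le] at hx
  have hsub : ∀ z ∈ uIcc x y, |z - x| ≤ |x - y| := fun z hz => by
    rw [abs_sub_comm x y]; exact abs_sub_left_of_mem_uIcc hz
  have hI : ∀ z ∈ uIcc x y, z ∈ Icc (-(R+1)) (R+1) := fun z hz => by
    have := (hsub z hz).trans hxy
    rw [abs_le] at this
    constructor <;> linarith
  have h1 : ∀ z ∈ uIcc x y, |deriv f z - deriv f x| ≤ max M 0 * |x - y| := fun z hz => by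
    have := (convex_uIcc x y).norm_image_sub_le_of_norm_deriv_le (f := deriv f) (C := max M 0)
      (fun w _ => hd1 w) (fun w hw => (hM w (hI w hw)).trans (le_max_left _ _)) left_mem_uIcc hz
    simp only [norm_eq_abs] at this
    exact this.trans (mul_le_mul_of_nonneg_left (hsub z hz) (le_max_right _ _))
  have h2 := (convex_uIcc x y).norm_image_sub_le_of_norm_hasDerivWithin_le
      (f := fun z => f z - deriv f x * z) (f' := fun z => deriv f z - deriv f x) (C := max M 0 * |x - y|)
      (fun w _ => by
        have := ((hd w).hasDerivAt.sub ((hasDerivAt_id w).const_mul (deriv f x)))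
        have h' := this.hasDerivWithinAt (s := uIcc x y)
        rw [mul_one] at h'
        exact h') (fun w hw => h1 w hw) left_mem_uIcc (right_mem_uIcc (a := x))
  simp only [norm_eq_abs] at h2
  rw [abs_sub_comm y x] at h2
  have h3 := (abs_le.1 h2).2
  have h4 : deriv f x * (y - x) ≤ |deriv f x| * |x - y| := by
    rw [abs_sub_comm, ← abs_mul]; exact le_abs_self _
  nlinarith

lemma poincare_of_T2 (μ : Measure ℝ) [IsProbabilityMeasure μ] (C : ℝ) (hC : 0 < C)
    (hT : ∀ ν : Measure ℝ, IsProbabilityMeasure ν →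
      transportCost (fun t => t ^ 2) μ ν ≤ ENNReal.ofReal C * relEnt ν μ)
    (f : ℝ → ℝ) (hs : ContDiff ℝ (⊤ : ℕ∞) f) (K : ℝ≥0) (hK : LipschitzWith K f) :
    (∫ x, f x ^ 2 ∂μ) - (∫ x, f x ∂μ) ^ 2 ≤ C * ∫ x, (deriv f x) ^ 2 ∂μ := by
  have hexp := exp_integrable_of_T2 μ C hC hT
  have i0 := lip_integrable hexp hK
  have hdc : Continuous (deriv f) := hs.continuous_deriv (by simp)
  have hdb : ∀ x, |deriv f x| ≤ K := fun x => norm_deriv_le_of_lipschitz hK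
  have hlipε : ∀ ε : ℝ, LipschitzWith (‖ε‖₊ * K) (fun x => ε * f x) := fun ε => by
    refine LipschitzWith.of_dist_le_mul fun x y => ?_
    have := hK.dist_le_mul x y
    rw [Real.dist_eq] at this ⊢
    rw [← mul_sub, abs_mul]
    push_cast
    rw [mul_assoc]
    exact mul_le_mul_of_nonneg_left this (abs_nonneg _)
  have hset : integrableExpSet f μ = univ := by
    ext t; simp only [integrableExpSet, mem_ofPred_eq, mem_univ, iff_true]
    exact lip_exp_integrable hexp (hlipε t)
  have hin : ∀ t, t ∈ interior (integrableExpSet f μ) := fun t => by rw [hset]; simp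
  -- variance
  have hvar : (∫ x, f x ^ 2 ∂μ) - (∫ x, f x ∂μ) ^ 2 = deriv (deriv (cgf f μ)) 0 := by
    have h1 := variance_tilted_mul (hin 0)
    have h2 : μ.tilted (fun x => 0 * f x) = μ := by
      simp only [zero_mul]; exact tilted_const μ 0
    rw [h2, variance_eq_sub (by exact_mod_cast memLp_of_mem_interior_integrableExpSet (hin 0) 2)] at h1
    rw [iteratedDeriv_succ, iteratedDeriv_one] at h1
    simpa using h1
  have hder : HasDerivAt (deriv (cgf f μ)) (deriv (deriv (cgf f μ)) 0) 0 :=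
    ((analyticAt_cgf (hin 0)).deriv).differentiableAt.hasDerivAt
  set V := (∫ x, f x ^ 2 ∂μ) - (∫ x, f x ∂μ) ^ 2 with hV
  rw [← hvar] at hder
  have hlim : Tendsto (fun ε => ((∫ x, f x ∂(μ.tilted (fun x => ε * f x))) - ∫ x, f x ∂μ) / ε) (𝓝[>] 0) (𝓝 V) := by
    have h1 := (hasDerivAt_iff_tendsto_slope.1 hder).mono_left
      (nhdsWithin_mono (0:ℝ) (fun x (hx : x ∈ Ioi (0:ℝ)) => (ne_of_gt hx : x ≠ 0)))
    refine h1.congr fun ε => ?_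
    rw [slope_def_field, integral_tilted_mul_self (hin ε), deriv_cgf_zero (hin 0), sub_zero]
    simp
  set G : ℕ → ℝ → ℝ := fun n x => if |x| ≤ n then |deriv f x| else K with hG
  have hGm : ∀ n, Measurable (G n) := fun n => by
    refine Measurable.ite (measurableSet_le (by fun_prop) measurable_const) hdc.abs.measurable measurable_const
  have hGb : ∀ n x, |G n x ^ 2| ≤ K ^ 2 := fun n x => by
    rw [abs_pow]
    refine pow_le_pow_left₀ (abs_nonneg _) ?_ 2
    simp only [hG]; split_ifs
    · rw [abs_abs]; exact hdb x
    · simp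
  have hGi : ∀ n, Integrable (fun x => G n x ^ 2) μ := fun n =>
    Integrable.of_bound ((hGm n).pow_const 2).aestronglyMeasurable (K ^ 2) (ae_of_all _ (hGb n))
  have main : ∀ n, V ≤ C * ∫ x, G n x ^ 2 ∂μ := by
    intro n
    obtain ⟨M, hM0, hM⟩ := taylor_loc hs n
    have hpt : ∀ x y, f y - f x ≤ G n x * |x - y| + (M + K) * |x - y| ^ 2 := by
      intro x y
      have hl : f y - f x ≤ K * |x - y| := by
        have := hK.dist_le_mul y x
        rw [Real.dist_eq, Real.dist_eq, abs_sub_comm y x] at this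
        exact (le_abs_self _).trans this
      have hp0 := abs_nonneg (x - y)
      have hK0 : (0:ℝ) ≤ K := K.2
      simp only [hG]
      split_ifs with h
      · by_cases h1 : |x - y| ≤ 1
        · have := hM x y h h1
          nlinarith [sq_nonneg |x - y|, mul_nonneg hK0 (sq_nonneg |x - y|)]
        · push Not at h1
          have h5 : (K:ℝ) * |x - y| ≤ K * |x - y| ^ 2 := mul_le_mul_of_nonneg_left (by nlinarith) hK0
          have h6 := mul_nonneg hM0 (sq_nonneg |x - y|)
          have h7 := mul_nonneg (abs_nonneg (deriv f x)) hp0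
          linarith
      · have h6 := mul_nonneg (add_nonneg hM0 hK0) (sq_nonneg |x - y|)
        linarith
    have hε : ∀ ε : ℝ, 0 < ε → ((∫ x, f x ∂(μ.tilted (fun x => ε * f x))) - ∫ x, f x ∂μ) / ε * (1 / 2) ≤
        C / 2 * (∫ x, G n x ^ 2 ∂μ) + ((M + K) * C) * ((∫ x, f x ∂(μ.tilted (fun x => ε * f x))) - ∫ x, f x ∂μ) := by
      intro ε hε
      have j0 := lip_integrable hexp (hlipε ε)
      have j1 := lip_exp_integrable hexp (hlipε ε)
      have j2 := lip_integrable_tilted hexp (hlipε ε)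
      have hpt' : ∀ x y, ε * f y - ε * f x ≤ C * ε ^ 2 / 2 * G n x ^ 2 + 0 + (1 / (2 * C) + ε * (M + K)) * (x - y) ^ 2 := by
        intro x y
        have h1 := mul_le_mul_of_nonneg_left (hpt x y) hε.le
        have h2 : C * ε ^ 2 / 2 * G n x ^ 2 + 0 + (1 / (2 * C) + ε * (M + K)) * (x - y) ^ 2
          - ε * (G n x * |x - y| + (M + K) * |x - y| ^ 2) = (C * ε * G n x - |x - y|) ^ 2 / (2 * C) := by
          rw [← sq_abs (x - y)]; field_simp; ring
        have h3 : 0 ≤ (C * ε * G n x - |x - y|) ^ 2 / (2 * C) := by positivity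
        linarith
      have hb := tilted_bound μ C hC hT _ j0 j1 j2 (fun x => C * ε ^ 2 / 2 * G n x ^ 2) (fun y => 0)
        (1 / (2 * C) + ε * (M + K)) ((hGi n).const_mul _)
        (by simp) (by positivity) hpt'
      have hj := integral_le_log_integral_exp μ _ j0 j1
      have hle : (1 / (2 * C) + ε * (M + K)) * (C * ((∫ x, ε * f x ∂(μ.tilted (fun x => ε * f x))) - log (∫ x, exp (ε * f x) ∂μ)))
        ≤ (1 / (2 * C) + ε * (M + K)) * (C * ((∫ x, ε * f x ∂(μ.tilted (fun x => ε * f x))) - ∫ x, ε * f x ∂μ)) := by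
        gcongr
      have hb2 := hb.trans (add_le_add_right hle _)
      simp only [integral_const_mul, integral_const, smul_zero, add_zero] at hb2
      set D := (∫ x, f x ∂(μ.tilted (fun x => ε * f x))) with hD
      set E := ∫ x, f x ∂μ
      set I := ∫ x, G n x ^ 2 ∂μ
      have e1 : C * ε ^ 2 / 2 * I + (1 / (2 * C) + ε * (M + K)) * (C * (ε * D - ε * E))
        = ε * (D - E) / 2 + ε ^ 2 * (C / 2 * I + (M + K) * C * (D - E)) := by
        field_simp; ring
      rw [e1] at hb2
      rw [div_mul_eq_mul_div, div_le_iff₀ hε]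
      nlinarith
    have hδ0 : Tendsto (fun ε => ((∫ x, f x ∂(μ.tilted (fun x => ε * f x))) - ∫ x, f x ∂μ)) (𝓝[>] 0) (𝓝 0) := by
      have h1 := hlim.mul (tendsto_id.mono_left (nhdsWithin_le_nhds (a := (0:ℝ)) (s := Ioi 0)))
      rw [mul_zero] at h1
      refine h1.congr' ?_
      filter_upwards [self_mem_nhdsWithin] with ε (hε : 0 < ε)
      simp only [id]; field_simp
    have h1 := hlim.mul_const (1 / 2)
    have h2 := (hδ0.const_mul ((M + K) * C)).const_add (C / 2 * (∫ x, G n x ^ 2 ∂μ))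
    have h3 := le_of_tendsto_of_tendsto h1 h2 (by
      filter_upwards [self_mem_nhdsWithin] with ε (h : 0 < ε) using hε ε h)
    linarith
  have hl2 : Tendsto (fun n => ∫ x, G n x ^ 2 ∂μ) atTop (𝓝 (∫ x, deriv f x ^ 2 ∂μ)) := by
    refine tendsto_integral_of_dominated_convergence (fun _ => (K:ℝ) ^ 2) (fun n => (hGi n).aestronglyMeasurable)
      (integrable_const _) (fun n => ae_of_all _ (hGb n)) (ae_of_all _ fun x => ?_)
    refine tendsto_const_nhds.congr' ?_
    filter_upwards [eventually_ge_atTop ⌈|x|⌉₊] with N hN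
    have : |x| ≤ N := (Nat.le_ceil _).trans (by exact_mod_cast hN)
    simp only [hG]
    rw [if_pos this, sq_abs]
  exact ge_of_tendsto (hl2.const_mul C) (Eventually.of_forall main)

end PartPB

section PartPC

def QuantLike (μ : Measure ℝ) (Q : ℝ → ℝ) : Prop :=
  ∀ t ∈ Ioo (0:ℝ) 1, t ≤ μ.real (Iic (Q t)) ∧ μ.real (Iio (Q t)) ≤ t

def Poinc (μ : Measure ℝ) (lam : ℝ) : Prop :=
  ∀ f : ℝ → ℝ, ContDiff ℝ (⊤ : ℕ∞) f → (∃ K : ℝ≥0, LipschitzWith K f) →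
        (∫ x, f x ^ 2 ∂μ) - (∫ x, f x ∂μ) ^ 2 ≤ lam * ∫ x, (deriv f x) ^ 2 ∂μ

lemma QuantLike.mono {μ : Measure ℝ} [IsProbabilityMeasure μ] {Q : ℝ → ℝ} (h : QuantLike μ Q)
    {s t : ℝ} (hs : 0 < s) (hst : s ≤ t) (ht : t < 1) : Q s ≤ Q t := by
  rcases hst.eq_or_lt with rfl | hlt
  · exact le_rfl
  by_contra hc
  push Not at hc
  have h1 := (h t ⟨hs.trans hlt, ht⟩).1
  have h2 := (h s ⟨hs, hlt.trans ht⟩).2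
  have h3 : μ.real (Iic (Q t)) ≤ μ.real (Iio (Q s)) :=
    measureReal_mono (fun x (hx : x ≤ Q t) => lt_of_le_of_lt hx hc)
  linarith

lemma exists_bump (p q : ℝ) (hpq : p ≤ q) : ∃ β : ℝ → ℝ, ContDiff ℝ (⊤ : ℕ∞) β ∧ (∀ x, 0 ≤ β x) ∧
    (∀ x, β x ≤ 1) ∧ (∀ x, x ∉ Ioo p q → β x = 0) ∧ (q - p) / 2 ≤ ∫ x in p..q, β x := by
  rcases hpq.eq_or_lt with rfl | hlt
  · exact ⟨fun _ => 0, contDiff_const, by simp, by simp, by simp, by simp⟩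
  let b : ContDiffBump ((p + q) / 2) := ⟨(q - p) / 4, (q - p) / 2, by linarith, by linarith⟩
  have hc : Continuous b := b.contDiff (n := (0 : ℕ∞)).continuous
  refine ⟨b, b.contDiff, fun x => b.nonneg, fun x => b.le_one, fun x hx => ?_, ?_⟩
  · apply b.zero_of_le_dist
    show (q - p) / 2 ≤ _
    rw [Real.dist_eq]
    by_contra h
    push Not at h
    rw [abs_lt] at h
    exact hx ⟨by linarith, by linarith⟩
  · have h1 : ∫ x in (p + (q - p) / 4)..(q - (q - p) / 4), b x = (q - p) / 2 := by
      have : ∫ x in (p + (q - p) / 4)..(q - (q - p) / 4), b x =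
          ∫ x in (p + (q - p) / 4)..(q - (q - p) / 4), (1:ℝ) := by
        refine intervalIntegral.integral_congr fun x hx => ?_
        rw [uIcc_of_le (by linarith)] at hx
        apply b.one_of_mem_closedBall
        rw [Metric.mem_closedBall, Real.dist_eq, abs_le]
        show -((q - p) / 4) ≤ _ ∧ _ ≤ (q - p) / 4
        constructor <;> linarith [hx.1, hx.2]
      rw [this]; simp; ring
    rw [← h1]
    refine intervalIntegral.integral_mono_interval (by linarith) (by linarith) (by linarith)
      (ae_of_all _ fun x => b.nonneg) (hc.intervalIntegrable _ _)

lemma variance_lower (μ : Measure ℝ) [IsProbabilityMeasure μ] (f : ℝ → ℝ) (hf : Measurable f)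
    (p q a L : ℝ) (hpq : p < q) (hb : ∀ x, |f x| ≤ |L|) (h0 : ∀ x ≤ p, f x = 0) (h1 : ∀ x, q ≤ x → f x = L)
    (ha0 : 0 ≤ a) (ha2 : a ≤ 1 / 2) (ha : a ≤ μ.real (Iic p)) (hq : μ.real (Iio q) ≤ 1 / 2) :
    a * L ^ 2 / 2 ≤ (∫ x, f x ^ 2 ∂μ) - (∫ x, f x ∂μ) ^ 2 := by
  have i1 : Integrable f μ := Integrable.of_bound hf.aestronglyMeasurable |L| (ae_of_all _ hb)
  have i2 : Integrable (fun x => f x ^ 2) μ :=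
    Integrable.of_bound (hf.pow_const 2).aestronglyMeasurable (|L| ^ 2) (ae_of_all _ fun x => by
      rw [norm_pow]; exact pow_le_pow_left₀ (abs_nonneg _) (hb x) 2)
  set e := ∫ x, f x ∂μ with he
  have i3 : Integrable (fun x => f x ^ 2 - 2 * e * f x) μ := i2.sub (i1.const_mul _)
  have hv : (∫ x, f x ^ 2 ∂μ) - e ^ 2 = ∫ x, (f x - e) ^ 2 ∂μ := by
    have : (fun x => (f x - e) ^ 2) = fun x => (f x ^ 2 - 2 * e * f x) + e ^ 2 := by
      ext x; ring
    rw [this, integral_add i3 (integrable_const _), integral_sub i2 (i1.const_mul _), integral_const_mul]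
    simp; ring
  have i4 : Integrable (fun x => (f x - e) ^ 2) μ := by
    have : (fun x => (f x - e) ^ 2) = fun x => (f x ^ 2 - 2 * e * f x) + e ^ 2 := by
      ext x; ring
    rw [this]; exact i3.add (integrable_const _)
  rw [hv]
  have hle : ∫ x, ((Iic p).indicator (fun _ => e ^ 2) x + (Ici q).indicator (fun _ => (L - e) ^ 2) x) ∂μ
      ≤ ∫ x, (f x - e) ^ 2 ∂μ := by
    refine integral_mono (((integrable_const _).indicator measurableSet_Iic).add
      ((integrable_const _).indicator measurableSet_Ici)) i4 fun x => ?_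
    simp only [indicator, mem_Iic, mem_Ici]
    split_ifs with c1 c2 c2
    · linarith
    · rw [h0 x c1]; nlinarith
    · rw [h1 x c2]; nlinarith
    · simp; positivity
  rw [integral_add ((integrable_const _).indicator measurableSet_Iic)
      ((integrable_const _).indicator measurableSet_Ici), integral_indicator_const _ measurableSet_Iic,
      integral_indicator_const _ measurableSet_Ici] at hle
  refine le_trans ?_ hle
  have hB : 1 / 2 ≤ μ.real (Ici q) := by
    rw [← compl_Iio, probReal_compl_eq_one_sub measurableSet_Iio]; linarith
  simp only [smul_eq_mul]
  nlinarith [mul_le_mul_of_nonneg_right ha (sq_nonneg e), mul_le_mul_of_nonneg_right (ha2.trans hB) (sq_nonneg (L - e)), mul_nonneg ha0 (sq_nonneg (L - 2 * e))]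

lemma M_of_poincare (μ : Measure ℝ) [IsProbabilityMeasure μ] (lam : ℝ) (hlam : 0 ≤ lam) (hP : Poinc μ lam)
    (Q : ℝ → ℝ) (hQ : QuantLike μ Q) (a δ : ℝ) (ha : 0 < a) (t : ℕ → ℝ) (ht : Monotone t)
    (hta : a ≤ t 0) (N : ℕ) (htN : t N ≤ 1 / 2) (hδ : ∀ i < N, t (i + 1) - t i ≤ δ) (hδ0 : 0 ≤ δ) :
    ∑ i ∈ Finset.range N, (Q (t (i + 1)) - Q (t i)) ^ 2 ≤ 8 * lam * δ / a := by
  have htpos : ∀ i, 0 < t i := fun i => lt_of_lt_of_le ha (hta.trans (ht (Nat.zero_le i)))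
  have htle : ∀ i ≤ N, t i ≤ 1 / 2 := fun i hi => (ht hi).trans htN
  have hQm : ∀ i j, i ≤ j → j ≤ N → Q (t i) ≤ Q (t j) := fun i j hij hj =>
    hQ.mono (htpos i) (ht hij) (by linarith [htle j hj])
  have hbump : ∀ i, ∃ β : ℝ → ℝ, i < N → (ContDiff ℝ (⊤ : ℕ∞) β ∧ (∀ x, 0 ≤ β x) ∧
    (∀ x, β x ≤ 1) ∧ (∀ x, x ∉ Ioo (Q (t i)) (Q (t (i+1))) → β x = 0) ∧
      (Q (t (i+1)) - Q (t i)) / 2 ≤ ∫ x in (Q (t i))..(Q (t (i+1))), β x) := fun i => by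
    by_cases hi : i < N
    · obtain ⟨β, h⟩ := exists_bump _ _ (hQm i (i+1) (Nat.le_succ i) hi)
      exact ⟨β, fun _ => h⟩
    · exact ⟨0, fun h => absurd h hi⟩
  choose β hβ using hbump
  set d : ℕ → ℝ := fun i => Q (t (i + 1)) - Q (t i) with hd
  have hd0 : ∀ i < N, 0 ≤ d i := fun i hi => sub_nonneg.2 (hQm i (i+1) (Nat.le_succ i) hi)
  set φ : ℝ → ℝ := fun x => ∑ i ∈ Finset.range N, d i * β i x with hφ
  have hφs : ContDiff ℝ (⊤ : ℕ∞) φ := by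
    simp only [hφ]
    refine ContDiff.sum fun i hi => ?_
    exact contDiff_const.mul (hβ i (Finset.mem_range.1 hi)).1
  have hφc : Continuous φ := hφs.continuous
  have hterm : ∀ i ∈ Finset.range N, ∀ x, 0 ≤ d i * β i x := fun i hi x =>
    mul_nonneg (hd0 i (Finset.mem_range.1 hi)) ((hβ i (Finset.mem_range.1 hi)).2.1 x)
  have hφ0 : ∀ x, 0 ≤ φ x := fun x => Finset.sum_nonneg fun i hi => hterm i hi x
  have hφB : ∀ x, φ x ≤ ∑ i ∈ Finset.range N, d i := fun x => Finset.sum_le_sum fun i hi =>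
    mul_le_of_le_one_right (hd0 i (Finset.mem_range.1 hi)) ((hβ i (Finset.mem_range.1 hi)).2.2.1 x)
  set f : ℝ → ℝ := fun x => ∫ y in (Q (t 0))..x, φ y with hf
  have hfd : ∀ x, HasDerivAt f (φ x) x := fun x =>
    intervalIntegral.integral_hasDerivAt_right (hφc.intervalIntegrable _ _)
      (hφc.stronglyMeasurableAtFilter _ _) hφc.continuousAt
  have hderiv : deriv f = φ := funext fun x => (hfd x).deriv
  have hfdiff : Differentiable ℝ f := fun x => (hfd x).differentiableAt
  have hfs : ContDiff ℝ (⊤ : ℕ∞) f := by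
    rw [contDiff_infty_iff_deriv]
    exact ⟨hfdiff, hderiv ▸ hφs⟩
  have hB0 : 0 ≤ ∑ i ∈ Finset.range N, d i := (hφ0 0).trans (hφB 0)
  have hfl : LipschitzWith (∑ i ∈ Finset.range N, d i).toNNReal f := by
    refine lipschitzWith_of_nnnorm_deriv_le hfdiff fun x => ?_
    rw [hderiv, ← NNReal.coe_le_coe, coe_nnnorm, Real.coe_toNNReal _ hB0, norm_eq_abs, abs_of_nonneg (hφ0 x)]
    exact hφB x
  have hfm : Monotone f := monotone_of_deriv_nonneg hfdiff fun x => by rw [hderiv]; exact hφ0 x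
  have hz1 : ∀ x ≤ Q (t 0), φ x = 0 := fun x hx => Finset.sum_eq_zero fun i hi => by
    have hi' := Finset.mem_range.1 hi
    rw [(hβ i hi').2.2.2.1 x fun h => absurd h.1 (not_lt.2 (hx.trans (hQm 0 i (Nat.zero_le _) hi'.le))), mul_zero]
  have hz2 : ∀ x, Q (t N) ≤ x → φ x = 0 := fun x hx => Finset.sum_eq_zero fun i hi => by
    have hi' := Finset.mem_range.1 hi
    rw [(hβ i hi').2.2.2.1 x fun h => absurd h.2 (not_lt.2 ((hQm (i+1) N hi' le_rfl).trans hx)), mul_zero]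
  have hf0 : ∀ x ≤ Q (t 0), f x = 0 := fun x hx => by
    simp only [hf]
    rw [intervalIntegral.integral_congr (g := fun _ => (0:ℝ)) fun y hy => ?_]
    · simp
    · rw [uIcc_of_ge hx] at hy
      exact hz1 y hy.2
  have hfL : ∀ x, Q (t N) ≤ x → f x = f (Q (t N)) := fun x hx => by
    have : f x - f (Q (t N)) = 0 := by
      simp only [hf]
      rw [intervalIntegral.integral_interval_sub_left (hφc.intervalIntegrable _ _) (hφc.intervalIntegrable _ _)]
      rw [intervalIntegral.integral_congr (g := fun _ => (0:ℝ)) fun y hy => ?_]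
      · simp
      · rw [uIcc_of_le hx] at hy
        exact hz2 y hy.1
    linarith
  set L := f (Q (t N)) with hL
  have hLS : (∑ i ∈ Finset.range N, d i ^ 2) / 2 ≤ L := by
    have h1 : L = ∑ i ∈ Finset.range N, ∫ x in (Q (t i))..(Q (t (i+1))), φ x := by
      rw [intervalIntegral.sum_integral_adjacent_intervals (a := fun i => Q (t i))
        (fun k _ => hφc.intervalIntegrable _ _)]
    rw [h1, Finset.sum_div]
    refine Finset.sum_le_sum fun i hi => ?_
    have hi' := Finset.mem_range.1 hi
    have h2 : ∫ x in (Q (t i))..(Q (t (i+1))), d i * β i x ≤ ∫ x in (Q (t i))..(Q (t (i+1))), φ x := by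
      refine intervalIntegral.integral_mono_on (hQm i (i+1) (Nat.le_succ i) hi')
        ((continuous_const.mul (hβ i hi').1.continuous).intervalIntegrable _ _)
        (hφc.intervalIntegrable _ _) fun x _ => ?_
      exact Finset.single_le_sum (f := fun i => d i * β i x) (fun j hj => hterm j hj x) hi
    rw [intervalIntegral.integral_const_mul] at h2
    have h3 := mul_le_mul_of_nonneg_left (hβ i hi').2.2.2.2 (hd0 i hi')
    have h4 : d i * ((Q (t (i+1)) - Q (t i)) / 2) = d i ^ 2 / 2 := by simp only [hd]; ring
    linarith
  have hS0 : 0 ≤ ∑ i ∈ Finset.range N, d i ^ 2 := Finset.sum_nonneg fun i _ => sq_nonneg _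
  set S := ∑ i ∈ Finset.range N, d i ^ 2 with hS
  rcases hS0.eq_or_lt with hS' | hSpos
  · rw [← hS']; positivity
  have hLpos : 0 < L := by linarith
  have hlt : Q (t 0) < Q (t N) := by
    by_contra h
    have := hf0 (Q (t N)) (not_lt.1 h)
    linarith
  have ht01 : t 0 ∈ Ioo (0:ℝ) 1 := ⟨htpos 0, by linarith [htle 0 (Nat.zero_le N)]⟩
  have htN1 : t N ∈ Ioo (0:ℝ) 1 := ⟨htpos N, by linarith⟩
  have hva := variance_lower μ f hfdiff.continuous.measurable (Q (t 0)) (Q (t N)) a L hlt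
    (fun x => by
      have h1 : 0 ≤ f x := by
        have := hfm (min_le_left x (Q (t 0)))
        rwa [hf0 _ (min_le_right _ _)] at this
      have h2 : f x ≤ L := by
        have := hfm (le_max_left x (Q (t N)))
        rwa [hfL _ (le_max_right _ _)] at this
      rw [abs_of_nonneg h1, abs_of_pos hLpos]; exact h2) hf0 hfL ha.le
      (hta.trans (htle 0 (Nat.zero_le N))) (hta.trans (hQ _ ht01).1) ((hQ _ htN1).2.trans htN)
  have hpo := hP f hfs ⟨_, hfl⟩
  rw [hderiv] at hpo
  have hen : ∫ x, φ x ^ 2 ∂μ ≤ δ * S := by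
    have hpt : ∀ x, φ x ^ 2 ≤ ∑ i ∈ Finset.range N, (Ioo (Q (t i)) (Q (t (i+1)))).indicator (fun _ => d i ^ 2) x := by
      intro x
      by_cases hx : ∃ i ∈ Finset.range N, x ∈ Ioo (Q (t i)) (Q (t (i+1)))
      · obtain ⟨i, hi, hxi⟩ := hx
        have hi' := Finset.mem_range.1 hi
        have h1 : φ x = d i * β i x := by
          refine Finset.sum_eq_single_of_mem (f := fun i => d i * β i x) i hi fun j hj hji => ?_
          have hj' := Finset.mem_range.1 hj
          rw [(hβ j hj').2.2.2.1 x fun h => ?_, mul_zero]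
          rcases lt_or_gt_of_ne hji with hlt | hlt
          · exact absurd (hQm (j+1) i hlt hi'.le) (not_le.2 (hxi.1.trans h.2))
          · exact absurd (hQm (i+1) j hlt hj'.le) (not_le.2 (h.1.trans hxi.2))
        have h2 : φ x ^ 2 ≤ (Ioo (Q (t i)) (Q (t (i+1)))).indicator (fun _ => d i ^ 2) x := by
          rw [indicator_of_mem hxi, h1, mul_pow]
          exact mul_le_of_le_one_right (sq_nonneg _) (pow_le_one₀ ((hβ i hi').2.1 x) ((hβ i hi').2.2.1 x))
        refine h2.trans (Finset.single_le_sum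
          (f := fun i => (Ioo (Q (t i)) (Q (t (i+1)))).indicator (fun _ => d i ^ 2) x) (fun j _ => ?_) hi)
        exact indicator_nonneg (fun _ _ => sq_nonneg _) _
      · push Not at hx
        have h1 : φ x = 0 := Finset.sum_eq_zero fun i hi => by
          rw [(hβ i (Finset.mem_range.1 hi)).2.2.2.1 x (hx i hi), mul_zero]
        rw [h1]
        simp only [ne_eq, OfNat.ofNat_ne_zero, not_false_eq_true, zero_pow]
        exact Finset.sum_nonneg fun i _ => indicator_nonneg (fun _ _ => sq_nonneg _) _
    have hii : ∀ i ∈ Finset.range N, Integrable ((Ioo (Q (t i)) (Q (t (i+1)))).indicator (fun _ => d i ^ 2)) μ :=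
      fun i _ => (integrable_const _).indicator measurableSet_Ioo
    have hle := integral_mono (μ := μ) (f := fun x => φ x ^ 2)
      (Integrable.of_bound (hφc.pow 2).aestronglyMeasurable ((∑ i ∈ Finset.range N, d i) ^ 2) (ae_of_all _ fun x => by
        rw [norm_pow, norm_eq_abs, abs_of_nonneg (hφ0 x)]
        exact pow_le_pow_left₀ (hφ0 x) (hφB x) 2)) (integrable_finsetSum _ hii) hpt
    refine hle.trans ?_
    rw [integral_finsetSum _ hii, hS, Finset.mul_sum]
    refine Finset.sum_le_sum fun i hi => ?_
    have hi' := Finset.mem_range.1 hi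
    rw [integral_indicator_const _ measurableSet_Ioo, smul_eq_mul]
    refine mul_le_mul_of_nonneg_right ?_ (sq_nonneg _)
    have h1 := (hQ (t i) ⟨htpos i, by linarith [htle i hi'.le]⟩).1
    have h2 := (hQ (t (i+1)) ⟨htpos (i+1), by linarith [htle (i+1) hi']⟩).2
    rcases (hQm i (i+1) (Nat.le_succ i) hi').eq_or_lt with h | h
    · rw [h]; simpa using hδ0
    · have h3 : Ioo (Q (t i)) (Q (t (i+1))) = Iio (Q (t (i+1))) \ Iic (Q (t i)) := by
        ext x; simp [and_comm]
      have hsub : Iic (Q (t i)) ⊆ Iio (Q (t (i+1))) := fun x hx => lt_of_le_of_lt hx h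
      rw [h3, measureReal_sdiff hsub measurableSet_Iic]
      linarith [hδ i hi']
  have h5 : a * L ^ 2 / 2 ≤ lam * (δ * S) :=
    hva.trans (hpo.trans (mul_le_mul_of_nonneg_left hen hlam))
  rw [le_div_iff₀ ha]
  have h6 : (S / 2) ^ 2 ≤ L ^ 2 := pow_le_pow_left₀ (by positivity) hLS 2
  have h7 : a * (S / 2) ^ 2 ≤ a * L ^ 2 := mul_le_mul_of_nonneg_left h6 ha.le
  have h8 : S * (S * a) ≤ S * (8 * lam * δ) := by nlinarith
  exact le_of_mul_le_mul_left h8 hSpos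

end PartPC

section PartPD

def CLSI (μ : Measure ℝ) (C' : ℝ) : Prop :=
  ∀ φ : ℝ → ℝ, ContDiff ℝ (⊤ : ℕ∞) φ → ConvexOn ℝ Set.univ φ →
          (∃ K : ℝ≥0, LipschitzWith K φ) →
          Ent μ (fun x => Real.exp (φ x)) ≤
            ENNReal.ofReal C' *
              ∫⁻ x, ENNReal.ofReal ((deriv φ x) ^ 2 * Real.exp (φ x)) ∂μ

noncomputable def chi (u : ℝ) : ℝ := ∫ y in (0:ℝ)..u, Real.smoothTransition y

lemma chi_hasDerivAt (u : ℝ) : HasDerivAt chi (Real.smoothTransition u) u :=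
  intervalIntegral.integral_hasDerivAt_right (Real.smoothTransition.continuous.intervalIntegrable _ _)
    (Real.smoothTransition.continuous.stronglyMeasurableAtFilter _ _)
    Real.smoothTransition.continuous.continuousAt

lemma chi_deriv : deriv chi = Real.smoothTransition := funext fun x => (chi_hasDerivAt x).deriv

lemma chi_contDiff : ContDiff ℝ (⊤ : ℕ∞) chi := by
  rw [contDiff_infty_iff_deriv]
  refine ⟨fun x => (chi_hasDerivAt x).differentiableAt, ?_⟩
  rw [chi_deriv]; exact Real.smoothTransition.contDiff

lemma chi_convex : ConvexOn ℝ univ chi := by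
  refine MonotoneOn.convexOn_of_deriv convex_univ chi_contDiff.continuous.continuousOn
    (chi_contDiff.differentiable (by simp)).differentiableOn ?_
  rw [chi_deriv]
  exact Real.smoothTransition.monotone.monotoneOn _

lemma chi_lip : LipschitzWith 1 chi := by
  refine lipschitzWith_of_nnnorm_deriv_le (chi_contDiff.differentiable (by simp)) fun x => ?_
  rw [chi_deriv, ← NNReal.coe_le_coe, coe_nnnorm, norm_eq_abs, abs_of_nonneg (Real.smoothTransition.nonneg x)]
  exact Real.smoothTransition.le_one x

lemma chi_mono : Monotone chi :=
  monotone_of_deriv_nonneg (chi_contDiff.differentiable (by simp)) fun x => by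
    rw [chi_deriv]; exact Real.smoothTransition.nonneg x

lemma chi_zero (u : ℝ) (hu : u ≤ 0) : chi u = 0 := by
  unfold chi
  rw [intervalIntegral.integral_congr (g := fun _ => (0:ℝ)) fun y hy => ?_]
  · simp
  · rw [uIcc_of_ge hu] at hy
    exact Real.smoothTransition.zero_of_nonpos hy.2

lemma chi_nonneg (u : ℝ) : 0 ≤ chi u := by
  have := chi_mono (min_le_left u 0)
  rwa [chi_zero _ (min_le_right _ _)] at this

lemma chi_ge (u : ℝ) : u - 1 ≤ chi u := by
  by_cases hu : u ≤ 1
  · linarith [chi_nonneg u]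
  · push Not at hu
    have h1 : chi u = chi 1 + ∫ y in (1:ℝ)..u, Real.smoothTransition y := by
      unfold chi
      rw [intervalIntegral.integral_add_adjacent_intervals] <;>
      exact Real.smoothTransition.continuous.intervalIntegrable _ _
    have h2 : ∫ y in (1:ℝ)..u, Real.smoothTransition y = ∫ y in (1:ℝ)..u, (1:ℝ) := by
      refine intervalIntegral.integral_congr fun y hy => ?_
      rw [uIcc_of_le hu.le] at hy
      exact Real.smoothTransition.one_of_one_le hy.1
    rw [h1, h2]; simp; linarith [chi_nonneg 1]

lemma X_smooth (y l : ℝ) : ContDiff ℝ (⊤ : ℕ∞) (fun x => l * chi (y - x)) :=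
  contDiff_const.mul (chi_contDiff.comp (contDiff_const.sub contDiff_id))

lemma X_hasDeriv (y l x : ℝ) : HasDerivAt (fun x => l * chi (y - x)) (-(l * Real.smoothTransition (y - x))) x := by
  have h1 : HasDerivAt (fun x => y - x) (-1) x := by
    simpa using (hasDerivAt_id x).const_sub y
  have h2 := ((chi_hasDerivAt (y - x)).comp x h1).const_mul l
  refine h2.congr_deriv ?_
  ring

lemma X_lip (y l : ℝ) : LipschitzWith ‖l‖₊ (fun x => l * chi (y - x)) := by
  refine LipschitzWith.of_dist_le_mul fun x z => ?_
  have := chi_lip.dist_le_mul (y - x) (y - z)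
  rw [Real.dist_eq] at this ⊢
  rw [← mul_sub, abs_mul]
  refine mul_le_mul_of_nonneg_left (this.trans ?_) (abs_nonneg _)
  rw [Real.dist_eq, Real.dist_eq, abs_sub_comm x z]; simp

lemma X_convex (y l : ℝ) (hl : 0 ≤ l) : ConvexOn ℝ univ (fun x => l * chi (y - x)) := by
  refine ⟨convex_univ, fun a _ b _ s t hs ht hst => ?_⟩
  have := chi_convex.2 (mem_univ (y - a)) (mem_univ (y - b)) hs ht hst
  simp only [smul_eq_mul] at this ⊢
  have h : s * (y - a) + t * (y - b) = y - (s * a + t * b) := by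
    have : t = 1 - s := by linarith
    subst this; ring
  rw [h] at this
  nlinarith

/-- real form of the convex log-Sobolev inequality -/
lemma CLSI.real {μ : Measure ℝ} [IsProbabilityMeasure μ] {C' : ℝ} (hC : 0 < C') (h : CLSI μ C')
    (hexp : ∀ s > (0:ℝ), Integrable (fun x => Real.exp (s * |x|)) μ) {φ : ℝ → ℝ}
    (h1 : ContDiff ℝ (⊤ : ℕ∞) φ) (h2 : ConvexOn ℝ univ φ) {K : ℝ≥0} (h3 : LipschitzWith K φ) :
    (∫ x, exp (φ x) * φ x ∂μ) - (∫ x, exp (φ x) ∂μ) * log (∫ x, exp (φ x) ∂μ) ≤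
      C' * ∫ x, (deriv φ x) ^ 2 * exp (φ x) ∂μ := by
  have h4 := h φ h1 h2 ⟨K, h3⟩
  have i1 := lip_exp_integrable hexp h3
  have i3 := lip_mul_exp_integrable hexp h3
  have hdc : Continuous (deriv φ) := h1.continuous_deriv (by simp)
  have hdb : ∀ x, |deriv φ x| ≤ K := fun x => norm_deriv_le_of_lipschitz h3
  have i5 : Integrable (fun x => deriv φ x ^ 2 * exp (φ x)) μ := by
    refine (i1.const_mul ((K:ℝ) ^ 2)).mono' (by have := h1.continuous; fun_prop) (ae_of_all _ fun x => ?_)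
    rw [norm_mul, norm_pow, norm_eq_abs, norm_eq_abs, abs_exp]
    exact mul_le_mul_of_nonneg_right (pow_le_pow_left₀ (abs_nonneg _) (hdb x) 2) (exp_pos _).le
  unfold Ent at h4
  have i3' : Integrable (fun x => exp (φ x) * log (exp (φ x))) μ := by simpa only [Real.log_exp] using i3
  rw [if_pos i3'] at h4
  simp only [Real.log_exp] at h4
  rw [← ofReal_integral_eq_lintegral_ofReal i5 (ae_of_all _ fun x => by positivity),
    ← ENNReal.ofReal_mul hC.le] at h4
  refine (ENNReal.ofReal_le_ofReal_iff ?_).1 h4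
  exact mul_nonneg hC.le (integral_nonneg fun x => by positivity)

lemma poincare_mean (μ : Measure ℝ) [IsProbabilityMeasure μ] (lam : ℝ) (hlam : 0 ≤ lam) (hP : Poinc μ lam)
    (hexp : ∀ s > (0:ℝ), Integrable (fun x => Real.exp (s * |x|)) μ) (y : ℝ)
    (hF : 0 < μ.real (Iic y)) (hF2 : μ.real (Iic y) ≤ 1 / 2) :
    ∫ x, chi (y - x) ∂μ ≤ μ.real (Iic y) * √(2 * lam) := by
  set F := μ.real (Iic y) with hFdef
  have hX := X_smooth y 1
  have hL := X_lip y 1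
  simp only [one_mul] at hX hL
  have hd : deriv (fun x => chi (y - x)) = fun x => -(Real.smoothTransition (y - x)) := funext fun x => by
    have := (X_hasDeriv y 1 x).deriv
    simpa only [one_mul] using this
  have i1 := lip_integrable hexp hL
  have i2 := lip_sq_integrable hexp hL
  have hp := hP _ hX ⟨_, hL⟩
  rw [hd] at hp
  have hind : Integrable ((Iic y).indicator (fun _ => (1:ℝ))) μ := (integrable_const _).indicator measurableSet_Iic
  have h1 : ∫ x, (-(Real.smoothTransition (y - x))) ^ 2 ∂μ ≤ F := by
    have : ∫ x, (Iic y).indicator (fun _ => (1:ℝ)) x ∂μ = F := by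
      rw [integral_indicator_const _ measurableSet_Iic]; simp [hFdef]
    rw [← this]
    have hst : Continuous Real.smoothTransition := Real.smoothTransition.continuous
    refine integral_mono_of_nonneg (ae_of_all _ fun x => sq_nonneg _) hind (ae_of_all _ fun x => ?_)
    simp only [indicator, mem_Iic]
    split_ifs with h
    · rw [neg_sq]; exact pow_le_one₀ (Real.smoothTransition.nonneg _) (Real.smoothTransition.le_one _)
    · rw [Real.smoothTransition.zero_of_nonpos (by linarith)]; simp
  set m := ∫ x, chi (y - x) ∂μ with hm
  set S := ∫ x, chi (y - x) ^ 2 ∂μ with hS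
  have hm0 : 0 ≤ m := integral_nonneg fun x => chi_nonneg _
  have hcs : m ^ 2 ≤ F * S := by
    have h2 : ∀ c : ℝ, 0 ≤ S - 2 * c * m + c ^ 2 * F := by
      intro c
      have e : ∫ x, (chi (y - x) - c * (Iic y).indicator (fun _ => (1:ℝ)) x) ^ 2 ∂μ = S - 2 * c * m + c ^ 2 * F := by
        have : ∀ x, (chi (y - x) - c * (Iic y).indicator (fun _ => (1:ℝ)) x) ^ 2
          = chi (y - x) ^ 2 - 2 * c * chi (y - x) + c ^ 2 * (Iic y).indicator (fun _ => (1:ℝ)) x := by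
          intro x
          simp only [indicator, mem_Iic]
          split_ifs with h
          · ring
          · rw [chi_zero _ (by linarith)]; ring
        simp_rw [this]
        have i3 : Integrable (fun x => chi (y - x) ^ 2 - 2 * c * chi (y - x)) μ := i2.sub (i1.const_mul _)
        rw [integral_add i3 (hind.const_mul _), integral_sub i2 (i1.const_mul _),
          integral_const_mul, integral_const_mul, integral_indicator_const _ measurableSet_Iic]
        simp [hFdef, hm, hS]
      rw [← e]; exact integral_nonneg fun x => sq_nonneg _
    have h3 := h2 (m / F)
    have h4 : S - 2 * (m / F) * m + (m / F) ^ 2 * F = (F * S - m ^ 2) / F := by field_simp; ring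
    rw [h4] at h3
    have := (le_div_iff₀ hF).1 h3
    linarith
  have h5 : S ≤ 2 * lam * F := by
    have h6 : S - m ^ 2 ≤ lam * F := hp.trans (mul_le_mul_of_nonneg_left h1 hlam)
    have hS0 : 0 ≤ S := integral_nonneg fun x => sq_nonneg _
    nlinarith
  have h7 : m ^ 2 ≤ (F * √(2 * lam)) ^ 2 := by
    rw [mul_pow, Real.sq_sqrt (by positivity)]
    nlinarith
  exact (sq_le_sq₀ hm0 (by positivity)).1 h7

lemma cgf_bound (μ : Measure ℝ) [IsProbabilityMeasure μ] (lam : ℝ) (hlam : 0 ≤ lam) (hP : Poinc μ lam)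
    (hexp : ∀ s > (0:ℝ), Integrable (fun x => Real.exp (s * |x|)) μ) (C' : ℝ) (hC : 0 < C') (hL : CLSI μ C')
    (y : ℝ) (hF : 0 < μ.real (Iic y)) (hF2 : μ.real (Iic y) ≤ 1 / 2) :
    (∀ l, Integrable (fun x => exp (l * chi (y - x))) (cond μ (Iic y))) ∧
    ∀ l > 0, cgf (fun x => chi (y - x)) (cond μ (Iic y)) l ≤ l * √(2 * lam) + C' * l ^ 2 := by
  set F := μ.real (Iic y) with hFdef
  have hne : μ (Iic y) ≠ 0 := fun h => by simp [hFdef, Measure.real, h] at hF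
  have hpr : IsProbabilityMeasure (cond μ (Iic y)) := cond_isProbabilityMeasure hne
  set ν := cond μ (Iic y) with hν
  have hintegr : ∀ g : ℝ → ℝ, ∫ x, g x ∂ν = F⁻¹ * ∫ x in Iic y, g x ∂μ := fun g => by
    rw [hν, ProbabilityTheory.cond, integral_smul_measure, ENNReal.toReal_inv]; rfl
  have hintg : ∀ g : ℝ → ℝ, Integrable g μ → Integrable g ν := fun g hg => by
    rw [hν, ProbabilityTheory.cond]
    exact hg.restrict.smul_measure (ENNReal.inv_ne_top.2 hne)
  have hXint : ∀ l, Integrable (fun x => exp (l * chi (y - x))) ν := fun l =>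
    hintg _ (lip_exp_integrable hexp (X_lip y l))
  refine ⟨hXint, ?_⟩
  set X : ℝ → ℝ := fun x => chi (y - x) with hX
  have hset : integrableExpSet X ν = univ := by
    ext t; simp only [integrableExpSet, mem_ofPred_eq, mem_univ, iff_true]
    exact hXint t
  have hin : ∀ t, t ∈ interior (integrableExpSet X ν) := fun t => by rw [hset]; simp
  have hdiff : ∀ l, HasDerivAt (cgf X ν) (deriv (cgf X ν) l) l := fun l =>
    (analyticAt_cgf (hin l)).differentiableAt.hasDerivAt
  have key : ∀ l > 0, l * deriv (cgf X ν) l - cgf X ν l ≤ C' * l ^ 2 := by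
    intro l hl
    have hls := hL.real hC hexp (X_smooth y l) (X_convex y l hl.le) (X_lip y l)
    have i1 := lip_exp_integrable hexp (X_lip y l)
    have i3 := lip_mul_exp_integrable hexp (X_lip y l)
    rw [deriv_cgf (hin l)]
    have hWpos : 0 < mgf X ν l := mgf_pos (hXint l)
    set W := mgf X ν l with hW
    have eW : ∫ x in Iic y, exp (l * chi (y - x)) ∂μ = F * W := by
      rw [hW, mgf, hintegr]; field_simp; rfl
    set B := ∫ x, X x * exp (l * X x) ∂ν with hB
    have eB : ∫ x in Iic y, exp (l * chi (y - x)) * (l * chi (y - x)) ∂μ = F * (l * B) := by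
      have : ∀ x, exp (l * chi (y - x)) * (l * chi (y - x)) = l * (X x * exp (l * X x)) := fun x => by
        simp only [hX]; ring
      simp_rw [this]
      rw [integral_const_mul, hB, hintegr]; field_simp
    have v1 : ∫ x, exp (l * chi (y - x)) * (l * chi (y - x)) ∂μ = F * (l * B) := by
      rw [← eB, ← integral_indicator measurableSet_Iic]
      congr 1; ext x
      simp only [indicator, mem_Iic]
      split_ifs with h
      · rfl
      · rw [chi_zero _ (by linarith)]; simp
    have v2 : ∫ x, exp (l * chi (y - x)) ∂μ = F * W + (1 - F) := by
      rw [← integral_add_compl measurableSet_Iic i1, eW]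
      congr 1
      rw [setIntegral_congr_fun (g := fun _ => (1:ℝ)) measurableSet_Iic.compl fun x hx => ?_]
      · rw [integral_const, hFdef, ← probReal_compl_eq_one_sub measurableSet_Iic]; simp
      · simp only [mem_compl_iff, mem_Iic, not_le] at hx
        simp only
        rw [chi_zero _ (by linarith)]; simp
    have v3 : ∫ x, (deriv (fun x => l * chi (y - x)) x) ^ 2 * exp (l * chi (y - x)) ∂μ ≤ l ^ 2 * (F * W) := by
      rw [← eW, ← integral_const_mul, ← integral_indicator measurableSet_Iic]
      refine integral_mono_of_nonneg (ae_of_all _ fun x => by simp only [Pi.zero_apply]; positivity)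
        ((i1.const_mul _).indicator measurableSet_Iic) (ae_of_all _ fun x => ?_)
      simp only [(X_hasDeriv y l x).deriv]
      simp only [indicator, mem_Iic]
      split_ifs with h
      · refine mul_le_mul_of_nonneg_right ?_ (exp_pos _).le
        rw [neg_sq, mul_pow]
        exact mul_le_of_le_one_right (sq_nonneg _) (pow_le_one₀ (Real.smoothTransition.nonneg _) (Real.smoothTransition.le_one _))
      · rw [Real.smoothTransition.zero_of_nonpos (by linarith)]; simp
    rw [v1, v2] at hls
    have hconv : (F * W + (1 - F)) * log (F * W + (1 - F)) ≤ F * (W * log W) := by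
      have h1F : (0:ℝ) ≤ 1 - F := by linarith
      have := Real.convexOn_mul_log.2 (mem_Ici.2 hWpos.le) (mem_Ici.2 zero_le_one) hF.le h1F (by ring)
      simpa using this
    have h4 : F * (l * B) - F * (W * log W) ≤ C' * (l ^ 2 * (F * W)) := by
      have := mul_le_mul_of_nonneg_left v3 hC.le
      linarith
    have h5 : l * B - W * log W ≤ C' * l ^ 2 * W := by
      refine le_of_mul_le_mul_left ?_ hF
      linarith
    have h6 : cgf X ν l = log W := rfl
    rw [h6]
    have h7 : l * (B / W) - log W = (l * B - W * log W) / W := by field_simp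
    rw [h7, div_le_iff₀ hWpos]
    exact h5
  have hanti : AntitoneOn (fun l => cgf X ν l / l - C' * l) (Ioi 0) := by
    have hd : ∀ l ∈ Ioi (0:ℝ), HasDerivAt (fun l => cgf X ν l / l - C' * l)
        ((deriv (cgf X ν) l * l - cgf X ν l * 1) / l ^ 2 - C') l := fun l hl => by
      have h1 := ((hdiff l).div (hasDerivAt_id l) (ne_of_gt hl)).sub ((hasDerivAt_id l).const_mul C')
      refine h1.congr_deriv ?_
      simp only [id, mul_one]
    refine antitoneOn_of_deriv_nonpos (convex_Ioi 0) (fun l hl => (hd l hl).continuousAt.continuousWithinAt)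
      (fun l hl => ?_) (fun l hl => ?_)
    · rw [interior_Ioi] at hl ⊢
      exact (hd l hl).differentiableAt.differentiableWithinAt
    · rw [interior_Ioi] at hl
      rw [(hd l hl).deriv]
      have hl0 : 0 < l := hl
      rw [sub_nonpos, div_le_iff₀ (by positivity)]
      have := key l hl
      linarith
  have hlim : Tendsto (fun l => cgf X ν l / l - C' * l) (𝓝[>] 0) (𝓝 (∫ x, X x ∂ν)) := by
    have h0 := hdiff 0
    rw [deriv_cgf_zero (hin 0)] at h0
    have h1 := (hasDerivAt_iff_tendsto_slope.1 h0).mono_left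
      (nhdsWithin_mono (0:ℝ) (fun x (hx : x ∈ Ioi (0:ℝ)) => (ne_of_gt hx : x ≠ 0)))
    have h2 : Tendsto (fun l : ℝ => C' * l) (𝓝[>] 0) (𝓝 0) := by
      have : Tendsto (fun l : ℝ => C' * l) (𝓝 0) (𝓝 (C' * 0)) := (continuous_const.mul continuous_id).tendsto 0
      rw [mul_zero] at this
      exact this.mono_left nhdsWithin_le_nhds
    have h3 := h1.sub h2
    rw [sub_zero] at h3
    have e : (ν.real univ) = 1 := by simp
    rw [e, div_one] at h3
    refine h3.congr fun l => ?_
    rw [slope_def_field, cgf_zero]; simp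
  have hmean : ∫ x, X x ∂ν ≤ √(2 * lam) := by
    have h1 := poincare_mean μ lam hlam hP hexp y hF hF2
    rw [hintegr]
    have h2 : ∫ x in Iic y, X x ∂μ = ∫ x, chi (y - x) ∂μ := by
      rw [← integral_indicator measurableSet_Iic]
      congr 1; ext x
      simp only [indicator, mem_Iic]
      split_ifs with h
      · rfl
      · rw [chi_zero _ (by linarith)]
    rw [h2, inv_mul_le_iff₀ hF]
    exact h1
  intro l hl
  have h1 : cgf X ν l / l - C' * l ≤ ∫ x, X x ∂ν := by
    refine ge_of_tendsto hlim ?_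
    filter_upwards [Ioo_mem_nhdsGT hl] with e he
    exact hanti (mem_Ioi.2 he.1) (mem_Ioi.2 hl) he.2.le
  have h2 : cgf X ν l / l ≤ √(2 * lam) + C' * l := by linarith
  rw [div_le_iff₀ hl] at h2
  linarith

lemma tail_bound (μ : Measure ℝ) [IsProbabilityMeasure μ] (lam : ℝ) (hlam : 0 ≤ lam) (hP : Poinc μ lam)
    (hexp : ∀ s > (0:ℝ), Integrable (fun x => Real.exp (s * |x|)) μ) (C' : ℝ) (hC : 0 < C') (hL : CLSI μ C')
    (y : ℝ) (hF : 0 < μ.real (Iic y)) (hF2 : μ.real (Iic y) ≤ 1 / 2) (u : ℝ) (hu : 0 < u) :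
    μ.real (Iic (y - (u + 1 + √(2 * lam)))) ≤ μ.real (Iic y) * exp (- (u ^ 2 / (4 * C'))) := by
  obtain ⟨hi, hb⟩ := cgf_bound μ lam hlam hP hexp C' hC hL y hF hF2
  have hne : μ (Iic y) ≠ 0 := fun h => by simp [Measure.real, h] at hF
  have hpr : IsProbabilityMeasure (cond μ (Iic y)) := cond_isProbabilityMeasure hne
  set M := √(2 * lam) with hM
  have hM0 : 0 ≤ M := Real.sqrt_nonneg _
  set l := u / (2 * C') with hl
  have hl0 : 0 < l := by positivity
  have h1 := measure_ge_le_exp_cgf (μ := cond μ (Iic y)) (X := fun x => chi (y - x)) (u + M) hl0.le (hi l)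
  have h2 : exp (-l * (u + M) + cgf (fun x => chi (y - x)) (cond μ (Iic y)) l) ≤ exp (- (u ^ 2 / (4 * C'))) := by
    refine exp_le_exp.2 ?_
    have := hb l hl0
    have e : -l * u + C' * l ^ 2 = - (u ^ 2 / (4 * C')) := by rw [hl]; field_simp; ring
    linarith
  have h3 : (cond μ (Iic y)).real (Iic (y - (u + 1 + M))) ≤ (cond μ (Iic y)).real {x | u + M ≤ chi (y - x)} := by
    refine measureReal_mono fun x hx => ?_
    have hx' : x ≤ y - (u + 1 + M) := hx
    have := chi_ge (y - x)
    show u + M ≤ chi (y - x)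
    linarith
  have h4 : (cond μ (Iic y)).real (Iic (y - (u + 1 + M))) = (μ.real (Iic y))⁻¹ * μ.real (Iic (y - (u + 1 + M))) := by
    rw [Measure.real, cond_apply measurableSet_Iic, ENNReal.toReal_mul, ENNReal.toReal_inv]
    simp only [Measure.real]
    congr 3
    ext x; simp only [mem_inter_iff, mem_Iic, and_iff_right_iff_imp]
    intro h; linarith
  rw [h4] at h3
  have h5 := h3.trans (h1.trans h2)
  rwa [inv_mul_le_iff₀ hF] at h5

lemma G_of (μ : Measure ℝ) [IsProbabilityMeasure μ] (lam : ℝ) (hlam : 0 ≤ lam) (hP : Poinc μ lam)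
    (hexp : ∀ s > (0:ℝ), Integrable (fun x => Real.exp (s * |x|)) μ) (C' : ℝ) (hC : 0 < C') (hL : CLSI μ C')
    (Q : ℝ → ℝ) (hQ : QuantLike μ Q) (s t : ℝ) (hs : 0 < s) (hst : s ≤ t) (ht : t ≤ 1 / 2) :
    (Q t - Q s) ^ 2 ≤ (8 * C' + 2 * (1 + √(2 * lam)) ^ 2) * (1 + log (t / s)) := by
  set M := √(2 * lam) with hM
  have hM0 : 0 ≤ M := Real.sqrt_nonneg _
  have hlog : 0 ≤ log (t / s) := Real.log_nonneg ((one_le_div hs).2 hst)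
  have hmono : Q s ≤ Q t := hQ.mono hs hst (by linarith)
  set u := Q t - Q s - (1 + M) with hu
  by_cases hu0 : u ≤ 0
  · have h1 : (Q t - Q s) ^ 2 ≤ (1 + M) ^ 2 := pow_le_pow_left₀ (by linarith) (by linarith) 2
    nlinarith [mul_nonneg (sq_nonneg (1 + M)) hlog, mul_nonneg hC.le hlog]
  push Not at hu0
  have key : ∀ η, 0 < η → η < u → (u - η) ^ 2 ≤ 4 * C' * log (t / s) := by
    intro η h1 h2
    have a1 := (hQ s ⟨hs, by linarith⟩).1
    have a2 := (hQ t ⟨by linarith, by linarith⟩).2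
    have a3 : μ.real (Iic (Q t - η)) ≤ t :=
      (measureReal_mono (fun x (hx : x ≤ Q t - η) => (by show x < Q t; linarith))).trans a2
    have a4 : s ≤ μ.real (Iic (Q t - η)) :=
      a1.trans (measureReal_mono (Iic_subset_Iic.2 (by linarith)))
    have a5 := tail_bound μ lam hlam hP hexp C' hC hL (Q t - η) (by linarith) (by linarith) (u - η) (by linarith)
    have a6 : Q t - η - (u - η + 1 + √(2 * lam)) = Q s := by rw [hu]; ring
    rw [a6] at a5
    have a7 : s ≤ t * exp (-((u - η) ^ 2 / (4 * C'))) :=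
      a1.trans (a5.trans (mul_le_mul_of_nonneg_right a3 (exp_pos _).le))
    have a8 : exp ((u - η) ^ 2 / (4 * C')) ≤ t / s := by
      rw [le_div_iff₀ hs]
      have := mul_le_mul_of_nonneg_left a7 (exp_pos ((u - η) ^ 2 / (4 * C'))).le
      rw [mul_left_comm, ← exp_add] at this
      simpa using this
    have a9 := (Real.le_log_iff_exp_le (by apply div_pos <;> linarith)).2 a8
    rw [div_le_iff₀ (by positivity)] at a9
    linarith
  have h3 : u ^ 2 ≤ 4 * C' * log (t / s) := by
    have hlim : Tendsto (fun η : ℝ => (u - η) ^ 2) (𝓝[>] 0) (𝓝 (u ^ 2)) := by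
      have : Tendsto (fun η : ℝ => (u - η) ^ 2) (𝓝 0) (𝓝 ((u - 0) ^ 2)) :=
        (Continuous.tendsto (by fun_prop) 0)
      rw [sub_zero] at this
      exact this.mono_left nhdsWithin_le_nhds
    refine le_of_tendsto hlim ?_
    filter_upwards [Ioo_mem_nhdsGT hu0] with η hη using key η hη.1 hη.2
  have h4 : Q t - Q s = u + (1 + M) := by rw [hu]; ring
  rw [h4]
  nlinarith [sq_nonneg (u - (1 + M)), mul_nonneg (sq_nonneg (1 + M)) hlog]

end PartPD

section PartPE

noncomputable def rho0 (x : ℝ) : ℝ := x ^ 2 / (1 + x)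
noncomputable def rhot (x : ℝ) : ℝ := (x / (1 + x)) ^ 2

lemma rho0_step (y z : ℝ) (hy : 0 ≤ y) (hz : 0 ≤ z) :
    2 * rho0 ((y + z) / 2) + (1 / 4) * rhot ((y + z) / 2) ≤ rho0 z + 4 * rho0 y := by
  have e1 : 2 * rho0 ((y + z) / 2) = (y + z) ^ 2 / (2 + y + z) := by
    unfold rho0; field_simp; ring
  have e2 : rhot ((y + z) / 2) = (y + z) ^ 2 / (2 + y + z) ^ 2 := by
    unfold rhot; field_simp; ring
  rw [e1, e2]; unfold rho0
  have h1 : 0 < 1 + y := by linarith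
  have h2 : 0 < 1 + z := by linarith
  have h3 : 0 < 2 + y + z := by linarith
  rw [← sub_nonneg]
  have : z ^ 2 / (1 + z) + 4 * (y ^ 2 / (1 + y)) -
      ((y + z) ^ 2 / (2 + y + z) + 1 / 4 * ((y + z) ^ 2 / (2 + y + z) ^ 2)) =
      (7/4*z^2 + 3/4*z^3 - 9/2*(y*z) - 7/4*(y*z^2) - 1/4*(y*z^3) + 55/4*y^2 + 89/4*(y^2*z)
       + 29/2*(y^2*z^2) + 3*(y^2*z^3) + 51/4*y^3 + 71/4*(y^3*z) + 6*(y^3*z^2) + 3*y^4 + 3*(y^4*z)) /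
      ((1 + z) * (1 + y) * (2 + y + z) ^ 2) := by
    field_simp; ring
  rw [this]
  apply div_nonneg _ (by positivity)
  have q1 : 0 ≤ 7/4*z^2 - 9/2*(y*z) + 55/4*y^2 := by nlinarith [sq_nonneg (z - 2 * y), sq_nonneg y]
  have q2 : 0 ≤ z * (1/4*z^2 - 7/4*(y*z) + 89/4*y^2) := by
    apply mul_nonneg hz; nlinarith [sq_nonneg (z - 4 * y), sq_nonneg y]
  have q3 : 0 ≤ z^3 * (1/2 - 1/4*y + 3*y^2) := by
    apply mul_nonneg (by positivity); nlinarith [sq_nonneg (y - 1), sq_nonneg y]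
  have q4 : 0 ≤ 29/2*(y^2*z^2) + 51/4*y^3 + 71/4*(y^3*z) + 6*(y^3*z^2) + 3*y^4 + 3*(y^4*z) := by
    positivity
  nlinarith

lemma rho0_le (x : ℝ) (hx : 0 ≤ x) : rho0 x ≤ x := by
  unfold rho0; rw [div_le_iff₀ (by linarith)]; nlinarith

lemma rho0_nonneg (x : ℝ) (hx : 0 ≤ x) : 0 ≤ rho0 x := by unfold rho0; positivity
lemma rhot_nonneg (x : ℝ) : 0 ≤ rhot x := by unfold rhot; positivity

lemma rhot_two_mul (x : ℝ) (hx : 0 ≤ x) : rhot (2 * x) ≤ 4 * rhot x := by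
  unfold rhot
  have : (2 * x) / (1 + 2 * x) ≤ 2 * (x / (1 + x)) := by
    rw [div_le_iff₀ (by linarith), mul_div_assoc', div_mul_eq_mul_div, le_div_iff₀ (by linarith)]
    nlinarith
  have h0 : 0 ≤ (2 * x) / (1 + 2 * x) := by positivity
  nlinarith [pow_le_pow_left₀ h0 this 2]

lemma rhot_sum_le (S α h : ℕ → ℝ) (H : ℝ) (hα : ∀ j, 0 ≤ α j) (hS : ∀ j, 0 ≤ S j)
    (hrec : ∀ j, S j = α j + S (j + 1))
    (hh : ∀ j, (1/2 : ℝ) ^ (j + 1) * rho0 (α j / (1/2 : ℝ) ^ (j + 1)) ≤ 4 * h j)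
    (hSl : Tendsto S atTop (𝓝 0)) (hH : ∀ n, ∑ j ∈ Finset.range n, h j ≤ H) (n : ℕ) :
    ∑ j ∈ Finset.range n, (1/2 : ℝ) ^ j * rhot (S j / (1/2 : ℝ) ^ j) ≤ 128 * H := by
  have key : ∀ n, 2 * ((1/2 : ℝ) ^ 0 * rho0 (S 0 / (1/2 : ℝ) ^ 0)) + (1/4) * ∑ j ∈ Finset.range n, (1/2 : ℝ) ^ j * rhot (S j / (1/2 : ℝ) ^ j)
      ≤ 32 * (∑ j ∈ Finset.range n, h j) + 2 * ((1/2 : ℝ) ^ n * rho0 (S n / (1/2 : ℝ) ^ n)) := by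
    intro n
    induction n with
    | zero => simp
    | succ k ih =>
      rw [Finset.sum_range_succ, Finset.sum_range_succ]
      have hr : (0:ℝ) < (1/2 : ℝ) ^ k := by positivity
      have hr1 : (1/2 : ℝ) ^ (k + 1) = (1/2 : ℝ) ^ k / 2 := by rw [pow_succ]; ring
      have e : S k / (1/2 : ℝ) ^ k = (α k / (1/2 : ℝ) ^ (k+1) + S (k+1) / (1/2 : ℝ) ^ (k+1)) / 2 := by
        rw [hr1, hrec k]; field_simp
      have st := rho0_step (α k / (1/2 : ℝ) ^ (k+1)) (S (k+1) / (1/2 : ℝ) ^ (k+1))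
        (by have := hα k; positivity) (by have := hS (k+1); positivity)
      rw [← e] at st
      have := mul_le_mul_of_nonneg_left st hr.le
      have h2 := hh k
      rw [hr1] at h2 this ⊢
      generalize rho0 (α k / _) = A at *
      nlinarith
  have key2 : ∀ m, n ≤ m → ∑ j ∈ Finset.range n, (1/2 : ℝ) ^ j * rhot (S j / (1/2 : ℝ) ^ j) ≤ 128 * H + 8 * S m := by
    intro m hm
    have h1 := key m
    have h2 : (1/2 : ℝ) ^ m * rho0 (S m / (1/2 : ℝ) ^ m) ≤ S m := by
      have hr : (0:ℝ) < (1/2 : ℝ) ^ m := by positivity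
      have := mul_le_mul_of_nonneg_left (rho0_le (S m / (1/2 : ℝ) ^ m) (by have := hS m; positivity)) hr.le
      rwa [mul_div_cancel₀ _ hr.ne'] at this
    have h3 : 0 ≤ (1/2 : ℝ) ^ 0 * rho0 (S 0 / (1/2 : ℝ) ^ 0) := by
      have := rho0_nonneg (S 0 / (1/2 : ℝ) ^ 0) (by have := hS 0; positivity)
      positivity
    have h4 : ∑ j ∈ Finset.range n, (1/2 : ℝ) ^ j * rhot (S j / (1/2 : ℝ) ^ j) ≤ ∑ j ∈ Finset.range m, (1/2 : ℝ) ^ j * rhot (S j / (1/2 : ℝ) ^ j) := by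
      apply Finset.sum_le_sum_of_subset_of_nonneg
      · intro x; simp; omega
      · intro j _ _; exact mul_nonneg (by positivity) (rhot_nonneg _)
    have := hH m
    linarith
  have hl : Tendsto (fun m => 128 * H + 8 * S m) atTop (𝓝 (128 * H + 8 * 0)) :=
    (hSl.const_mul 8).const_add _
  rw [mul_zero, add_zero] at hl
  exact ge_of_tendsto hl (eventually_atTop.2 ⟨n, key2⟩)

lemma rhot_sum_le' (S : ℕ → ℝ) (K : ℝ) (hS : ∀ j, 0 ≤ S j)
    (h : ∀ n, ∑ j ∈ Finset.range n, (1/2 : ℝ) ^ j * rhot (S j / (1/2 : ℝ) ^ j) ≤ K) (n : ℕ) :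
    ∑ j ∈ Finset.range n, (1/2 : ℝ) ^ j * rhot (S (j - 1) / (1/2 : ℝ) ^ j) ≤ 3 * K := by
  have hnn : ∀ j, 0 ≤ (1/2 : ℝ) ^ j * rhot (S j / (1/2 : ℝ) ^ j) := fun j => mul_nonneg (by positivity) (rhot_nonneg _)
  have hK : 0 ≤ K := by have := h 0; simpa using this
  cases n with
  | zero => simpa using hK
  | succ n =>
    rw [Finset.sum_range_succ']
    have h1 := h 1
    simp only [Finset.sum_range_one] at h1
    have : ∑ k ∈ Finset.range n, (1/2 : ℝ) ^ (k+1) * rhot (S (k + 1 - 1) / (1/2 : ℝ) ^ (k+1)) ≤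
        ∑ k ∈ Finset.range n, 2 * ((1/2 : ℝ) ^ k * rhot (S k / (1/2 : ℝ) ^ k)) := by
      apply Finset.sum_le_sum
      intro k _
      have e : S (k + 1 - 1) / (1/2 : ℝ) ^ (k+1) = 2 * (S k / (1/2 : ℝ) ^ k) := by
        rw [pow_succ]; simp; field_simp
      rw [e]
      have := rhot_two_mul (S k / (1/2 : ℝ) ^ k) (by have := hS k; positivity)
      have hr : (0:ℝ) < (1/2 : ℝ) ^ k := by positivity
      rw [pow_succ]
      nlinarith
    rw [← Finset.mul_sum] at this
    have := h n
    simp only [Nat.zero_sub]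
    linarith

/-- P sequence -/
noncomputable def Pfun (G r : ℝ) : ℝ := 2 * (max 0 (√(G / 2) - √r)) ^ 2

lemma L2_step (G G' r : ℝ) (hr : 0 < r) (hG' : 0 ≤ G') (hGG : G' ≤ G) :
    2 * (r / 2) * (max 1 (√(G / r / 2)) - 1) ≤
      (G - G') * log (max 1 (√(G / r / 2))) + Pfun G' (r / 2) - Pfun G r := by
  have hG : 0 ≤ G := hG'.trans hGG
  obtain ⟨p, hp⟩ : ∃ p, p = √(G / 2) := ⟨_, rfl⟩
  obtain ⟨q, hq⟩ : ∃ q, q = √r := ⟨_, rfl⟩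
  obtain ⟨p', hp'⟩ : ∃ p, p = √(G' / 2) := ⟨_, rfl⟩
  obtain ⟨q', hq'⟩ : ∃ q, q = √(r / 2) := ⟨_, rfl⟩
  have hp0 : 0 ≤ p := hp ▸ Real.sqrt_nonneg _
  have hq0 : 0 < q := hq ▸ Real.sqrt_pos.2 hr
  have hp'0 : 0 ≤ p' := hp' ▸ Real.sqrt_nonneg _
  have hq'0 : 0 < q' := hq' ▸ Real.sqrt_pos.2 (by linarith)
  have eG : G = 2 * p ^ 2 := by rw [hp, Real.sq_sqrt (by linarith)]; ring
  have eG' : G' = 2 * p' ^ 2 := by rw [hp', Real.sq_sqrt (by linarith)]; ring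
  have er : r = q ^ 2 := by rw [hq, Real.sq_sqrt (by linarith)]
  have er' : q ^ 2 = 2 * q' ^ 2 := by rw [hq', Real.sq_sqrt (by linarith), ← er]; ring
  have eb : √(G / r / 2) = p / q := by
    rw [hp, hq, ← Real.sqrt_div (by linarith)]; congr 1; field_simp
  have hpp : p' ≤ p := by rw [hp, hp']; exact Real.sqrt_le_sqrt (by linarith)
  unfold Pfun
  rw [← hp, ← hp', ← hq, ← hq', eb]
  rcases le_or_gt p q with h | h
  · rw [max_eq_left ((div_le_one hq0).2 h), max_eq_left (by linarith : p - q ≤ 0)]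
    simp
  · have hb : 1 ≤ p / q := (one_le_div hq0).2 h.le
    rw [max_eq_right hb, max_eq_right (by linarith : 0 ≤ p - q)]
    have hpos : 0 < p := by linarith
    have hl : 1 - q / p ≤ log (p / q) := by
      have := Real.one_sub_inv_le_log_of_pos (show 0 < p / q by positivity)
      rwa [inv_div] at this
    have hm := mul_le_mul_of_nonneg_left hl (sub_nonneg.2 hGG)
    have l1 : 2 * (r / 2) * (p / q - 1) = q * (p - q) := by
      rw [er]; field_simp
    rw [l1]
    rcases le_or_gt q' p' with h' | h'
    · rw [max_eq_right (by linarith : 0 ≤ p' - q')]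
      have : q * (p - q) ≤ (G - G') * (1 - q / p) + 2 * (p' - q') ^ 2 - 2 * (p - q) ^ 2 := by
        have hs : q = √2 * q' := by
          rw [hq, hq', ← Real.sqrt_mul (by norm_num)]; congr 1; ring
        have h2 : √2 ^ 2 = 2 := Real.sq_sqrt (by norm_num)
        rw [← sub_nonneg]
        have e : (G - G') * (1 - q / p) + 2 * (p' - q') ^ 2 - 2 * (p - q) ^ 2 - q * (p - q) = q * (p - √2 * p') ^ 2 / p := by
          rw [eG, eG']
          field_simp
          have : q' = q * √2 / 2 := by rw [hs]; nlinarith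
          rw [this]
          ring_nf
          rw [h2]; ring
        rw [e]; positivity
      linarith
    · rw [max_eq_left (by linarith : p' - q' ≤ 0)]
      have : q * (p - q) ≤ (G - G') * (1 - q / p) - 2 * (p - q) ^ 2 := by
        rw [← sub_nonneg]
        have e : (G - G') * (1 - q / p) - 2 * (p - q) ^ 2 - q * (p - q) = (p - q) * (q * p - 2 * p' ^ 2) / p := by
          rw [eG, eG']
          field_simp
          ring
        rw [e]
        apply div_nonneg _ hpos.le
        apply mul_nonneg (by linarith)
        nlinarith
      norm_num
      linarith

lemma L2_sum (G h : ℕ → ℝ) (H : ℝ) (hG : ∀ j, 0 ≤ G j) (hanti : ∀ j, G (j + 1) ≤ G j)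
    (hh : ∀ j, ∀ b : ℝ, 0 < b → (G j - G (j + 1)) * log b - (1/2 : ℝ) ^ (j + 1) * (b - 1) ≤ h j)
    (hGl : Tendsto G atTop (𝓝 0)) (hH : ∀ n, ∑ j ∈ Finset.range n, h j ≤ H) (n : ℕ) :
    ∑ j ∈ Finset.range n, (G j - G (j + 1)) * max 0 (log (G j / (1/2 : ℝ) ^ j / 2)) ≤ 4 * H := by
  have key : ∀ n, ∑ j ∈ Finset.range n, (G j - G (j + 1)) * log (max 1 (√(G j / (1/2 : ℝ) ^ j / 2))) + Pfun (G 0) ((1/2 : ℝ) ^ 0)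
      ≤ 2 * (∑ j ∈ Finset.range n, h j) + Pfun (G n) ((1/2 : ℝ) ^ n) := by
    intro n
    induction n with
    | zero => simp
    | succ k ih =>
      rw [Finset.sum_range_succ, Finset.sum_range_succ]
      have hr1 : (1/2 : ℝ) ^ (k + 1) = (1/2 : ℝ) ^ k / 2 := by rw [pow_succ]; ring
      have st := L2_step (G k) (G (k+1)) ((1/2 : ℝ) ^ k) (by positivity) (hG _) (hanti k)
      have h2 := hh k (max 1 (√(G k / (1/2 : ℝ) ^ k / 2))) (by positivity)
      rw [hr1] at h2 ⊢
      linarith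
  have hP0 : ∀ a b, 0 ≤ Pfun a b := by intro a b; unfold Pfun; positivity
  have hP1 : ∀ m, Pfun (G m) ((1/2 : ℝ) ^ m) ≤ G m := by
    intro m
    unfold Pfun
    have h0 : max 0 (√(G m / 2) - √((1/2 : ℝ) ^ m)) ≤ √(G m / 2) :=
      max_le (Real.sqrt_nonneg _) (by linarith [Real.sqrt_nonneg ((1/2 : ℝ) ^ m)])
    have := pow_le_pow_left₀ (le_max_left _ _) h0 2
    rw [Real.sq_sqrt (by linarith [hG m])] at this
    linarith
  have hterm : ∀ j, (G j - G (j + 1)) * max 0 (log (G j / (1/2 : ℝ) ^ j / 2)) =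
      2 * ((G j - G (j + 1)) * log (max 1 (√(G j / (1/2 : ℝ) ^ j / 2)))) := by
    intro j
    have hx : 0 ≤ G j / (1/2 : ℝ) ^ j / 2 := by have := hG j; positivity
    generalize G j / (1/2 : ℝ) ^ j / 2 = x at *
    have : max 0 (log x) = 2 * log (max 1 (√x)) := by
      rcases le_or_gt x 1 with h | h
      · rw [max_eq_left (Real.log_nonpos hx h), max_eq_left (Real.sqrt_le_one.2 h)]; simp
      · rw [max_eq_right (Real.log_nonneg h.le), max_eq_right (Real.one_le_sqrt.2 h.le), Real.log_sqrt hx]; ring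
    rw [this]; ring
  have hnn : ∀ j, 0 ≤ (G j - G (j + 1)) * max 0 (log (G j / (1/2 : ℝ) ^ j / 2)) :=
    fun j => mul_nonneg (by linarith [hanti j]) (le_max_left _ _)
  have key2 : ∀ m, n ≤ m → ∑ j ∈ Finset.range n, (G j - G (j + 1)) * max 0 (log (G j / (1/2 : ℝ) ^ j / 2)) ≤ 4 * H + 2 * G m := by
    intro m hm
    have h4 : ∑ j ∈ Finset.range n, (G j - G (j + 1)) * max 0 (log (G j / (1/2 : ℝ) ^ j / 2)) ≤ ∑ j ∈ Finset.range m, (G j - G (j + 1)) * max 0 (log (G j / (1/2 : ℝ) ^ j / 2)) := by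
      apply Finset.sum_le_sum_of_subset_of_nonneg
      · intro x; simp; omega
      · intro j _ _; exact hnn j
    rw [Finset.sum_congr rfl (fun j (_ : j ∈ Finset.range m) => hterm j), ← Finset.mul_sum] at h4
    have := key m
    have := hH m
    have := hP1 m
    have := hP0 (G 0) ((1/2 : ℝ) ^ 0)
    linarith
  have hl : Tendsto (fun m => 4 * H + 2 * G m) atTop (𝓝 (4 * H + 2 * 0)) :=
    (hGl.const_mul 2).const_add _
  rw [mul_zero, add_zero] at hl
  exact ge_of_tendsto hl (eventually_atTop.2 ⟨n, key2⟩)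

end PartPE

section PartPF

open InformationTheory (klFun)

lemma klFun_ge_tangent (u b : ℝ) (hu : 0 ≤ u) (hb : 0 < b) : u * log b - b + 1 ≤ klFun u := by
  unfold InformationTheory.klFun
  rcases hu.eq_or_lt with rfl | hu
  · simp; linarith
  · have := Real.one_sub_inv_le_log_of_pos (show 0 < u / b by positivity)
    rw [Real.log_div hu.ne' hb.ne', inv_div] at this
    have h2 := mul_le_mul_of_nonneg_left this hu.le
    have : u * (1 - b / u) = u - b := by field_simp
    linarith

lemma klFun_ge_rho0 (u : ℝ) (hu : 0 ≤ u) : rho0 |u - 1| / 4 ≤ klFun u := by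
  have h1 : (√u - 1) ^ 2 ≤ klFun u := by
    unfold InformationTheory.klFun
    rcases hu.eq_or_lt with rfl | hu
    · simp
    · have hs : 0 < √u := Real.sqrt_pos.2 hu
      have hsq : √u ^ 2 = u := Real.sq_sqrt hu.le
      have := Real.one_sub_inv_le_log_of_pos hs
      rw [Real.log_sqrt hu.le] at this
      have h2 := mul_le_mul_of_nonneg_left this (show 0 ≤ 2 * u by linarith)
      have : 2 * u * (1 - (√u)⁻¹) = 2 * u - 2 * √u := by
        nth_rw 1 [← hsq]; nth_rw 3 [← hsq]; field_simp
      nlinarith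
  refine le_trans ?_ h1
  unfold rho0
  have hsq : √u ^ 2 = u := Real.sq_sqrt hu
  have e : |u - 1| ^ 2 = (√u - 1) ^ 2 * (√u + 1) ^ 2 := by
    rw [sq_abs]; nth_rw 1 [← hsq]; ring
  have ha := abs_nonneg (u - 1)
  rw [e, div_div, div_le_iff₀ (by positivity)]
  apply mul_le_mul_of_nonneg_left _ (sq_nonneg _)
  nlinarith [sq_nonneg (√u - 1), le_abs_self (u - 1)]

lemma rho0_tangent (x y : ℝ) (hx : 0 ≤ x) (hy : 0 ≤ y) :
    rho0 y + (1 - 1 / (1 + y) ^ 2) * (x - y) ≤ rho0 x := by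
  unfold rho0
  rw [← sub_nonneg]
  have : x ^ 2 / (1 + x) - (y ^ 2 / (1 + y) + (1 - 1 / (1 + y) ^ 2) * (x - y)) =
      (x - y) ^ 2 / ((1 + x) * (1 + y) ^ 2) := by
    field_simp; ring
  rw [this]; positivity

structure Dens (γ : ℝ → ℝ) : Prop where
  meas : Measurable γ
  nonneg : ∀ t, 0 ≤ γ t
  supp : ∀ t, t ∉ Ioc (0:ℝ) 1 → γ t = 0
  int : Integrable γ
  one : ∫ t, γ t = 1
  kl : IntegrableOn (fun t => klFun (γ t)) (Ioc 0 1)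

noncomputable def Gm (γ : ℝ → ℝ) (t : ℝ) : ℝ := ∫ s in Iic t, γ s
noncomputable def rhoM (γ : ℝ → ℝ) : Measure ℝ := volume.withDensity (fun t => ENNReal.ofReal (γ t))

variable {γ : ℝ → ℝ}

lemma Dens.sub (h : Dens γ) {a b : ℝ} (hab : a ≤ b) : Gm γ b - Gm γ a = ∫ s in Ioc a b, γ s := by
  unfold Gm
  rw [intervalIntegral.integral_Iic_sub_Iic h.int.integrableOn h.int.integrableOn,
    intervalIntegral.integral_of_le hab]

lemma Dens.mono (h : Dens γ) : Monotone (Gm γ) := by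
  intro a b hab
  have := h.sub hab
  have h2 : 0 ≤ ∫ s in Ioc a b, γ s := integral_nonneg h.nonneg
  linarith

lemma Dens.zero (h : Dens γ) {t : ℝ} (ht : t ≤ 0) : Gm γ t = 0 := by
  unfold Gm
  rw [setIntegral_congr_fun (g := fun _ => (0:ℝ)) measurableSet_Iic]
  · simp
  · intro s hs
    exact h.supp s (fun hh => by have := hh.1; have : s ≤ t := hs; linarith)

lemma Dens.eq_one (h : Dens γ) {t : ℝ} (ht : 1 ≤ t) : Gm γ t = 1 := by
  unfold Gm
  rw [← h.one]
  apply setIntegral_eq_integral_of_forall_compl_eq_zero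
  intro s hs
  exact h.supp s (fun hh => hs (by have := hh.2; show s ≤ t; linarith))

lemma Dens.Gnonneg (h : Dens γ) (t : ℝ) : 0 ≤ Gm γ t := integral_nonneg h.nonneg

lemma Dens.cont (h : Dens γ) : Continuous (Gm γ) := by
  have : Gm γ = fun t => (∫ s in (0:ℝ)..t, γ s) := by
    ext t
    have h0 := h.zero le_rfl
    have := intervalIntegral.integral_Iic_sub_Iic (a := 0) (b := t) (f := γ) (μ := volume) h.int.integrableOn h.int.integrableOn
    unfold Gm at *
    linarith
  rw [this]
  exact intervalIntegral.continuous_primitive (fun a b => h.int.intervalIntegrable) 0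

lemma Dens.eq0 (h : Dens γ) {t : ℝ} (ht : 0 ≤ t) : Gm γ t = ∫ s in Ioc 0 t, γ s := by
  rw [← h.sub ht, h.zero le_rfl, sub_zero]

lemma Dens.rho_apply (h : Dens γ) {A : Set ℝ} (hA : MeasurableSet A) :
    rhoM γ A = ENNReal.ofReal (∫ s in A, γ s) := by
  unfold rhoM
  rw [withDensity_apply _ hA, ofReal_integral_eq_lintegral_ofReal h.int.integrableOn
    (Eventually.of_forall h.nonneg)]

lemma Dens.rho_Iic (h : Dens γ) (t : ℝ) : rhoM γ (Iic t) = ENNReal.ofReal (Gm γ t) :=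
  h.rho_apply measurableSet_Iic

lemma Dens.rho_Ioc (h : Dens γ) {a b : ℝ} (hab : a ≤ b) :
    rhoM γ (Ioc a b) = ENNReal.ofReal (Gm γ b - Gm γ a) := by
  rw [h.rho_apply measurableSet_Ioc, h.sub hab]

lemma Dens.prob (h : Dens γ) : IsProbabilityMeasure (rhoM γ) :=
  ⟨by rw [h.rho_apply MeasurableSet.univ, setIntegral_univ, h.one]; simp⟩

lemma Dens.ae_mem (h : Dens γ) : ∀ᵐ t ∂(rhoM γ), t ∈ Ioc (0:ℝ) 1 := by
  rw [ae_iff]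
  change rhoM γ (Ioc (0:ℝ) 1)ᶜ = 0
  rw [h.rho_apply measurableSet_Ioc.compl,
    setIntegral_congr_fun (g := fun _ => (0:ℝ)) measurableSet_Ioc.compl (fun s hs => h.supp s hs)]
  simp

lemma Dens.map_eq (h : Dens γ) : (rhoM γ).map (Gm γ) = volume.restrict (Ioc 0 1) := by
  haveI := h.prob
  haveI : IsProbabilityMeasure ((rhoM γ).map (Gm γ)) := Measure.isProbabilityMeasure_map h.cont.measurable.aemeasurable
  apply Measure.ext_of_Iic
  intro a
  rw [Measure.map_apply h.cont.measurable measurableSet_Iic, Measure.restrict_apply measurableSet_Iic]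
  rcases lt_or_ge a 0 with ha | ha
  · have e1 : Gm γ ⁻¹' Iic a = ∅ := by
      ext t; simp; linarith [h.Gnonneg t]
    have e2 : Iic a ∩ Ioc (0:ℝ) 1 = ∅ := by
      ext t; simp; intros; linarith
    rw [e1, e2]; simp
  rcases le_or_gt 1 a with ha1 | ha1
  · have e1 : Gm γ ⁻¹' Iic a = univ := by
      ext t; simp
      have := h.mono (le_max_left t 1)
      rw [h.eq_one (le_max_right t 1)] at this
      linarith
    have e2 : Iic a ∩ Ioc (0:ℝ) 1 = Ioc 0 1 := by
      ext t; simp; intros; linarith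
    rw [e1, e2]; simp
  · have hne : (Gm γ ⁻¹' Iic a).Nonempty := ⟨0, by simp [h.zero le_rfl, ha]⟩
    have hbd : BddAbove (Gm γ ⁻¹' Iic a) := ⟨1, by
      intro t ht
      by_contra hh
      push Not at hh
      have : Gm γ t ≤ a := ht
      rw [h.eq_one hh.le] at this
      linarith⟩
    have hcl : IsClosed (Gm γ ⁻¹' Iic a) := isClosed_Iic.preimage h.cont
    have hmem := hcl.csSup_mem hne hbd
    set t0 := sSup (Gm γ ⁻¹' Iic a) with ht0
    have e1 : Gm γ ⁻¹' Iic a = Iic t0 := by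
      ext t
      constructor
      · intro ht; exact le_csSup hbd ht
      · intro ht
        exact (h.mono ht).trans hmem
    have e3 : Gm γ t0 = a := by
      obtain ⟨t1, ht1, e⟩ := intermediate_value_Icc (zero_le_one' ℝ) h.cont.continuousOn
        (show a ∈ Icc (Gm γ 0) (Gm γ 1) by rw [h.zero le_rfl, h.eq_one le_rfl]; exact ⟨ha, ha1.le⟩)
      apply le_antisymm hmem
      rw [← e]
      exact h.mono (le_csSup hbd (by show Gm γ t1 ≤ a; rw [e]))
    have e2 : Iic a ∩ Ioc (0:ℝ) 1 = Ioc 0 a := by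
      ext t; simp; constructor
      · rintro ⟨h1, h2, h3⟩; exact ⟨h2, h1⟩
      · rintro ⟨h1, h2⟩; exact ⟨h2, h1, by linarith⟩
    rw [e1, e2, h.rho_Iic, e3]; simp

/-- integrated kl bounds on a measurable subset -/
lemma Dens.kl_tangent (h : Dens γ) {a b : ℝ} (ha : 0 ≤ a) (hab : a ≤ b) (hb : b ≤ 1) (c : ℝ) (hc : 0 < c) :
    (Gm γ b - Gm γ a) * log c - (b - a) * (c - 1) ≤ ∫ s in Ioc a b, klFun (γ s) := by
  have hsub : Ioc a b ⊆ Ioc (0:ℝ) 1 := fun t ht => ⟨ha.trans_lt ht.1, ht.2.trans hb⟩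
  have hi : IntegrableOn (fun s => γ s * log c - (c - 1)) (Ioc a b) := by
    apply Integrable.sub
    · exact h.int.integrableOn.mul_const _
    · exact integrable_const _
  have := setIntegral_mono_on hi (h.kl.mono_set hsub) measurableSet_Ioc (fun s _ => by
    have := klFun_ge_tangent (γ s) c (h.nonneg s) hc
    show γ s * log c - (c - 1) ≤ _
    linarith)
  rw [integral_sub (h.int.integrableOn.mul_const _) (integrable_const _), integral_mul_const, ← h.sub hab] at this
  simp [max_eq_left (sub_nonneg.2 hab), hab] at this
  linarith

lemma Dens.intabs (h : Dens γ) (a b : ℝ) : IntegrableOn (fun s => |γ s - 1|) (Ioc a b) := by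
  have : IntegrableOn (fun s => γ s - 1) (Ioc a b) := Integrable.sub h.int.integrableOn (integrable_const _)
  exact this.abs

lemma Dens.kl_rho0 (h : Dens γ) {a b : ℝ} (ha : 0 ≤ a) (hab : a < b) (hb : b ≤ 1) :
    (b - a) * rho0 ((∫ s in Ioc a b, |γ s - 1|) / (b - a)) ≤ 4 * ∫ s in Ioc a b, klFun (γ s) := by
  have hsub : Ioc a b ⊆ Ioc (0:ℝ) 1 := fun t ht => ⟨ha.trans_lt ht.1, ht.2.trans hb⟩
  obtain ⟨A, hA⟩ : ∃ A, A = ∫ s in Ioc a b, |γ s - 1| := ⟨_, rfl⟩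
  have hA0 : 0 ≤ A := hA ▸ integral_nonneg (fun s => abs_nonneg _)
  rw [← hA]
  have hd : 0 < b - a := by linarith
  obtain ⟨y, hy⟩ : ∃ y, y = A / (b - a) := ⟨_, rfl⟩
  have hy0 : 0 ≤ y := by rw [hy]; positivity
  rw [← hy]
  obtain ⟨k, hk⟩ : ∃ k, k = 1 - 1 / (1 + y) ^ 2 := ⟨_, rfl⟩
  have i1 : IntegrableOn (fun s => (k / 4) * |γ s - 1|) (Ioc a b) := (h.intabs a b).const_mul _
  have i2 : IntegrableOn (fun _ : ℝ => (rho0 y - k * y) / 4) (Ioc a b) := integrable_const _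
  have := setIntegral_mono_on (i1.add i2) (h.kl.mono_set hsub) measurableSet_Ioc (fun s _ => by
    have h1 := klFun_ge_rho0 (γ s) (h.nonneg s)
    have h2 := rho0_tangent |γ s - 1| y (abs_nonneg _) hy0
    rw [← hk] at h2
    show (k / 4) * |γ s - 1| + (rho0 y - k * y) / 4 ≤ _
    linarith)
  change ∫ s in Ioc a b, ((k / 4) * |γ s - 1| + (rho0 y - k * y) / 4) ≤ _ at this
  rw [integral_add i1 i2, integral_const_mul, ← hA] at this
  simp [hab.le] at this
  have e : A = y * (b - a) := by rw [hy]; field_simp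
  rw [e] at this
  linarith

lemma Dens.abs_sub_le (h : Dens γ) {t r : ℝ} (ht : 0 ≤ t) (htr : t ≤ r) :
    |Gm γ t - t| ≤ ∫ s in Ioc 0 r, |γ s - 1| := by
  have e : Gm γ t - t = ∫ s in Ioc 0 t, (γ s - 1) := by
    rw [integral_sub h.int.integrableOn (integrable_const _), ← h.eq0 ht]
    simp [ht]
  rw [e]
  refine (abs_integral_le_integral_abs).trans ?_
  exact setIntegral_mono_set (h.intabs 0 r) (Eventually.of_forall fun s => abs_nonneg _)
    (Ioc_subset_Ioc_right htr).eventuallyLE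

lemma dyadic_cover : Ioc (0:ℝ) 1 = ⋃ j : ℕ, Ioc ((1/2:ℝ) ^ (j+1)) ((1/2:ℝ) ^ j) := by
  ext t
  simp only [mem_iUnion]
  constructor
  · rintro ⟨h0, h1⟩
    obtain ⟨n, hn1, hn2⟩ := exists_nat_pow_near_of_lt_one h0 h1 (show (0:ℝ) < 1/2 by norm_num) (by norm_num)
    exact ⟨n, hn1, hn2⟩
  · rintro ⟨j, h1, h2⟩
    exact ⟨lt_trans (by positivity) h1, h2.trans (pow_le_one₀ (by norm_num) (by norm_num))⟩

lemma Dens.sum_kl (h : Dens γ) (n : ℕ) :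
    ∑ j ∈ Finset.range n, ∫ s in Ioc ((1/2:ℝ) ^ (j+1)) ((1/2:ℝ) ^ j), klFun (γ s) ≤
      ∫ s in Ioc 0 1, klFun (γ s) := by
  have : ∑ j ∈ Finset.range n, ∫ s in Ioc ((1/2:ℝ) ^ (j+1)) ((1/2:ℝ) ^ j), klFun (γ s) =
      ∫ s in Ioc ((1/2:ℝ) ^ n) 1, klFun (γ s) := by
    induction n with
    | zero => simp
    | succ k ih =>
      have h1 : (1/2:ℝ) ^ (k+1) ≤ (1/2:ℝ) ^ k := pow_le_pow_of_le_one (by norm_num) (by norm_num) (by omega)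
      have h2 : (1/2:ℝ) ^ k ≤ 1 := pow_le_one₀ (by norm_num) (by norm_num)
      have h3 : (0:ℝ) < (1/2:ℝ) ^ (k+1) := by positivity
      rw [Finset.sum_range_succ, ih, ← Ioc_union_Ioc_eq_Ioc h1 h2, setIntegral_union _ measurableSet_Ioc, add_comm]
      · exact h.kl.mono_set (Ioc_subset_Ioc h3.le h2)
      · exact h.kl.mono_set (Ioc_subset_Ioc (h3.le.trans h1) le_rfl)
      · rw [Set.disjoint_left]; intro x hx hy; exact absurd hx.2 (not_le.2 hy.1)
  rw [this]
  apply setIntegral_mono_set h.kl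
  · exact Eventually.of_forall fun s => InformationTheory.klFun_nonneg (h.nonneg s)
  · exact (Ioc_subset_Ioc_left (by positivity)).eventuallyLE

end PartPF

section PartPG

open InformationTheory (klFun)

variable {γ : ℝ → ℝ}

noncomputable def Sg (γ : ℝ → ℝ) (j : ℕ) : ℝ := ∫ s in Ioc 0 ((1/2:ℝ) ^ j), |γ s - 1|

lemma half_pow_succ_le (k : ℕ) : (1/2:ℝ) ^ (k+1) ≤ (1/2:ℝ) ^ k :=
  pow_le_pow_of_le_one (by norm_num) (by norm_num) (by omega)
lemma half_pow_le_one (k : ℕ) : (1/2:ℝ) ^ k ≤ 1 := pow_le_one₀ (by norm_num) (by norm_num)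

lemma Sg_nonneg (j : ℕ) : 0 ≤ Sg γ j := integral_nonneg fun _ => abs_nonneg _

lemma tendsto_half : Tendsto (fun j : ℕ => (1/2:ℝ) ^ j) atTop (𝓝 0) :=
  tendsto_pow_atTop_nhds_zero_of_lt_one (by norm_num) (by norm_num)

lemma Dens.Sg_tendsto (h : Dens γ) : Tendsto (Sg γ) atTop (𝓝 0) := by
  have hi : Integrable (fun s => |γ s - 1|) (volume.restrict (Ioc 0 1)) := h.intabs 0 1
  have hI : IntegrableOn (fun s => |γ s - 1|) (Icc 0 1) := by
    rw [integrableOn_Icc_iff_integrableOn_Ioc]; exact hi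
  have := intervalIntegral.continuousOn_primitive hI
  have h0 := this 0 ⟨le_rfl, zero_le_one⟩
  have h2 : Tendsto (fun j : ℕ => (1/2:ℝ) ^ j) atTop (𝓝[Icc 0 1] 0) :=
    tendsto_nhdsWithin_iff.2 ⟨tendsto_half, Eventually.of_forall fun j => ⟨by positivity, half_pow_le_one j⟩⟩
  have h3 := h0.tendsto.comp h2
  simp only [Function.comp_def, Ioc_self, Measure.restrict_empty, integral_zero_measure] at h3
  exact h3

lemma Dens.sum_rhot (h : Dens γ) (n : ℕ) :
    ∑ j ∈ Finset.range n, (1/2 : ℝ) ^ j * rhot (Sg γ (j - 1) / (1/2 : ℝ) ^ j) ≤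
      384 * ∫ s in Ioc 0 1, klFun (γ s) := by
  have h1 := rhot_sum_le' (Sg γ) (128 * ∫ s in Ioc 0 1, klFun (γ s)) Sg_nonneg (by
    apply rhot_sum_le (Sg γ) (fun j => ∫ s in Ioc ((1/2:ℝ) ^ (j+1)) ((1/2:ℝ) ^ j), |γ s - 1|)
      (fun j => ∫ s in Ioc ((1/2:ℝ) ^ (j+1)) ((1/2:ℝ) ^ j), klFun (γ s)) _ _ Sg_nonneg _ _ h.Sg_tendsto h.sum_kl
    · intro j; exact integral_nonneg fun _ => abs_nonneg _
    · intro j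
      unfold Sg
      rw [← Ioc_union_Ioc_eq_Ioc (by positivity) (half_pow_succ_le j), setIntegral_union _ measurableSet_Ioc, add_comm]
      · exact h.intabs _ _
      · exact h.intabs _ _
      · rw [Set.disjoint_left]; intro x hx hy; exact absurd hx.2 (not_le.2 hy.1)
    · intro j
      have := h.kl_rho0 (a := (1/2:ℝ) ^ (j+1)) (b := (1/2:ℝ) ^ j) (by positivity)
        (pow_lt_pow_right_of_lt_one₀ (by norm_num) (by norm_num) (by omega)) (half_pow_le_one j)
      have e : (1/2:ℝ) ^ j - (1/2:ℝ) ^ (j+1) = (1/2:ℝ) ^ (j+1) := by rw [pow_succ]; ring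
      rwa [e] at this) n
  linarith

noncomputable def Lpl (γ : ℝ → ℝ) (t : ℝ) : ℝ := max 0 (log (Gm γ t / t) - log 4)
noncomputable def Lm (γ : ℝ → ℝ) (t : ℝ) : ℝ := max 0 (log (t / Gm γ t) - log 4)

lemma Dens.Lp_meas (h : Dens γ) : Measurable (Lpl γ) := by
  unfold Lpl
  have := h.cont.measurable
  fun_prop
lemma Dens.Lm_meas (h : Dens γ) : Measurable (Lm γ) := by
  unfold Lm
  have := h.cont.measurable
  fun_prop

lemma Dens.H_nonneg (h : Dens γ) : 0 ≤ ∫ s in Ioc 0 1, klFun (γ s) :=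
  integral_nonneg fun s => InformationTheory.klFun_nonneg (h.nonneg s)

lemma Dens.Lp_int (h : Dens γ) :
    ∫⁻ t, ENNReal.ofReal (Lpl γ t) ∂(rhoM γ) ≤ ENNReal.ofReal (4 * ∫ s in Ioc 0 1, klFun (γ s)) := by
  have hs : ∀ n, _ := L2_sum (fun j => Gm γ ((1/2:ℝ) ^ j))
    (fun j => ∫ s in Ioc ((1/2:ℝ) ^ (j+1)) ((1/2:ℝ) ^ j), klFun (γ s)) _ (fun j => h.Gnonneg _)
    (fun j => h.mono (half_pow_succ_le j)) (fun j b hb => by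
      have := h.kl_tangent (a := (1/2:ℝ) ^ (j+1)) (b := (1/2:ℝ) ^ j) (by positivity)
        (half_pow_succ_le j) (half_pow_le_one j) b hb
      have e : (1/2:ℝ) ^ j - (1/2:ℝ) ^ (j+1) = (1/2:ℝ) ^ (j+1) := by rw [pow_succ]; ring
      rwa [e] at this) (by
      have := (h.cont.tendsto 0).comp tendsto_half
      rwa [h.zero le_rfl] at this) h.sum_kl
  have hae : rhoM γ = (rhoM γ).restrict (Ioc 0 1) := by
    rw [Measure.restrict_eq_self_of_ae_mem h.ae_mem]
  rw [hae]
  nth_rw 1 [dyadic_cover]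
  refine (lintegral_iUnion_le _ _).trans ?_
  apply ENNReal.tsum_le_of_sum_range_le
  intro n
  refine le_trans ?_ (ENNReal.ofReal_le_ofReal (hs n))
  rw [ENNReal.ofReal_sum_of_nonneg (fun j _ => mul_nonneg (sub_nonneg.2 (h.mono (half_pow_succ_le j))) (le_max_left _ _))]
  apply Finset.sum_le_sum
  intro j _
  rw [mul_comm, ENNReal.ofReal_mul (le_max_left _ _), ← h.rho_Ioc (half_pow_succ_le j), ← setLIntegral_const]
  apply setLIntegral_mono measurable_const
  intro t ht
  apply ENNReal.ofReal_le_ofReal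
  unfold Lpl
  have hr : (0:ℝ) < (1/2:ℝ) ^ j := by positivity
  have hr1 : (1/2:ℝ) ^ (j+1) = (1/2:ℝ) ^ j / 2 := by rw [pow_succ]; ring
  have ht0 : 0 < t := lt_trans (by positivity) ht.1
  have ht1 := ht.1
  rw [hr1] at ht1
  rcases (h.Gnonneg t).eq_or_lt with h0 | h0
  · rw [← h0]
    simp only [zero_div, Real.log_zero]
    rw [max_eq_left (by have := Real.log_nonneg (show (1:ℝ) ≤ 4 by norm_num); linarith)]
    exact le_max_left _ _
  · have h1 : Gm γ t ≤ Gm γ ((1/2:ℝ)^j) := h.mono ht.2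
    apply max_le_max le_rfl
    rw [← Real.log_div (by positivity) (by norm_num)]
    apply Real.log_le_log (by positivity)
    rw [div_div, div_div, div_le_div_iff₀ (by positivity) (by positivity)]
    nlinarith

lemma Dens.Lm_int (h : Dens γ) :
    ∫⁻ t, ENNReal.ofReal (Lm γ t) ∂(rhoM γ) ≤ ENNReal.ofReal (5/2 * ∫ s in Ioc 0 1, klFun (γ s)) := by
  have hcl : IsClosed {t | Gm γ t ≤ t / 4} := isClosed_le h.cont (continuous_id.div_const 4)
  have hc : IsCompact (Icc (0:ℝ) 1 ∩ {t | Gm γ t ≤ t / 4}) := isCompact_Icc.inter_right hcl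
  obtain ⟨ts, ⟨⟨hts0, hts1⟩, htsG⟩, hmax⟩ := hc.exists_isGreatest ⟨0, ⟨le_rfl, zero_le_one⟩, by
    show Gm γ 0 ≤ 0 / 4; rw [h.zero le_rfl]; simp⟩
  have htsG : Gm γ ts ≤ ts / 4 := htsG
  have hH : 2/5 * ts ≤ ∫ s in Ioc 0 1, klFun (γ s) := by
    have h1 := h.kl_tangent (a := 0) (b := ts) le_rfl hts0 hts1 (1/4) (by norm_num)
    have h2 : ∫ s in Ioc 0 ts, klFun (γ s) ≤ ∫ s in Ioc 0 1, klFun (γ s) := by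
      apply setIntegral_mono_set h.kl
      · exact Eventually.of_forall fun s => InformationTheory.klFun_nonneg (h.nonneg s)
      · exact (Ioc_subset_Ioc_right hts1).eventuallyLE
    rw [h.zero le_rfl] at h1
    have h3 : log (1/4 : ℝ) = - (2 * log 2) := by
      rw [show (1/4:ℝ) = (2^2)⁻¹ by norm_num, Real.log_inv, Real.log_pow]; norm_num
    rw [h3] at h1
    have := Real.log_two_lt_d9
    have h4 : Gm γ ts * log 2 ≤ ts / 4 * 0.6931471808 :=
      mul_le_mul htsG this.le (Real.log_nonneg (by norm_num)) (by linarith)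
    nlinarith
  have hG1 : Gm γ ts ≤ 1 := by linarith
  have hbound : ∀ᵐ t ∂(rhoM γ), ENNReal.ofReal (Lm γ t) ≤
      (Ioc 0 (Gm γ ts)).indicator (fun w => ENNReal.ofReal (√ts * w ^ (-(1/2) : ℝ))) (Gm γ t) := by
    have hG0 : ∀ᵐ t ∂(rhoM γ), Gm γ t ∈ Ioc (0:ℝ) 1 := by
      have : ∀ᵐ w ∂((rhoM γ).map (Gm γ)), w ∈ Ioc (0:ℝ) 1 := by
        rw [h.map_eq]; exact ae_restrict_mem measurableSet_Ioc
      exact ae_of_ae_map h.cont.measurable.aemeasurable this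
    filter_upwards [h.ae_mem, hG0] with t ht hw
    obtain ⟨w, hwe⟩ : ∃ w, w = Gm γ t := ⟨_, rfl⟩
    by_cases htt : t ≤ ts
    · rw [indicator_of_mem (show Gm γ t ∈ Ioc 0 (Gm γ ts) from ⟨hw.1, h.mono htt⟩)]
      apply ENNReal.ofReal_le_ofReal
      unfold Lm
      rw [← hwe] at hw ⊢
      have hw0 := hw.1
      have ht0 := ht.1
      have e : √ts * w ^ (-(1/2) : ℝ) = √(ts / w) := by
        rw [Real.rpow_neg hw0.le, ← Real.sqrt_eq_rpow, Real.sqrt_div hts0]; rfl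
      rw [e]
      apply max_le (Real.sqrt_nonneg _)
      have hx : 0 < t / w / 4 := by positivity
      rw [← Real.log_div (by positivity) (by norm_num)]
      have h1 := Real.log_le_sub_one_of_pos (Real.sqrt_pos.2 hx)
      rw [Real.log_sqrt hx.le] at h1
      have h2 : √(t / w / 4) = √(t / w) / 2 := by
        rw [Real.sqrt_div (by positivity), show (4:ℝ) = 2 ^ 2 by norm_num, Real.sqrt_sq (by norm_num)]
      have h3 : √(t / w) ≤ √(ts / w) := Real.sqrt_le_sqrt (by gcongr)
      linarith
    · have : Lm γ t = 0 := by
        unfold Lm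
        apply max_eq_left
        have h1 : t / 4 < Gm γ t := by
          by_contra hh
          push Not at hh
          exact htt (hmax ⟨⟨ht.1.le, ht.2⟩, hh⟩)
        have h0 := ht.1
        have hw0 := hw.1
        rw [← Real.log_div (by positivity) (by norm_num)]
        apply Real.log_nonpos (by positivity)
        rw [div_div, div_le_one (by positivity)]
        linarith
      rw [this]; simp
  have hmeas : Measurable ((Ioc 0 (Gm γ ts)).indicator (fun w => ENNReal.ofReal (√ts * w ^ (-(1/2) : ℝ)))) := by
    apply Measurable.indicator _ measurableSet_Ioc
    fun_prop
  refine (lintegral_mono_ae hbound).trans ?_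
  rw [← lintegral_map hmeas h.cont.measurable, h.map_eq, lintegral_indicator measurableSet_Ioc,
    Measure.restrict_restrict measurableSet_Ioc, inter_eq_self_of_subset_left (Ioc_subset_Ioc_right hG1)]
  have hw0 := h.Gnonneg ts
  have hii : IntegrableOn (fun w : ℝ => √ts * w ^ (-(1/2) : ℝ)) (Ioc 0 (Gm γ ts)) := by
    apply Integrable.const_mul
    have := intervalIntegral.intervalIntegrable_rpow' (a := 0) (b := Gm γ ts) (r := -(1/2)) (by norm_num)
    exact (intervalIntegrable_iff_integrableOn_Ioc_of_le hw0).1 this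
  rw [← ofReal_integral_eq_lintegral_ofReal hii]
  · apply ENNReal.ofReal_le_ofReal
    rw [integral_const_mul, ← intervalIntegral.integral_of_le hw0, integral_rpow (Or.inl (by norm_num))]
    norm_num
    rw [← Real.sqrt_eq_rpow]
    have h1 : √(Gm γ ts) ≤ √ts / 2 := by
      have := Real.sqrt_le_sqrt htsG
      rwa [Real.sqrt_div hts0, show (4:ℝ) = 2 ^ 2 by norm_num, Real.sqrt_sq (by norm_num)] at this
    have h2 := Real.sqrt_nonneg ts
    have h3 := Real.sq_sqrt hts0
    nlinarith
  · filter_upwards [ae_restrict_mem measurableSet_Ioc] with w hw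
    have := hw.1
    show 0 ≤ √ts * w ^ (-(1/2) : ℝ)
    positivity

end PartPG

section PartPH

open InformationTheory (klFun)

variable {γ : ℝ → ℝ}

lemma good_block (V : ℝ → ℝ) (hV : MonotoneOn V (Ioi 0)) (CM : ℝ)
    (a E : ℝ) (ha : 0 < a) (hE : 0 < E)
    (hM : ∀ N : ℕ, ∑ i ∈ Finset.range N, (V (a + ((i + 1 : ℕ) : ℝ) * E) - V (a + (i : ℝ) * E)) ^ 2 ≤ CM * E / a) :
    ∫⁻ w in Ioi (a + E), ENNReal.ofReal ((V (w + E) - V (w - E)) ^ 2) ≤ ENNReal.ofReal (9 * CM * E ^ 2 / a) := by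
  obtain ⟨d, hd⟩ : ∃ d : ℕ → ℝ, d = fun i => V (a + ((i + 1 : ℕ) : ℝ) * E) - V (a + (i : ℝ) * E) := ⟨_, rfl⟩
  have hM' : ∀ N : ℕ, ∑ i ∈ Finset.range N, d i ^ 2 ≤ CM * E / a := by
    intro N; rw [hd]; exact hM N
  have hcov : Ioi (a + E) ⊆ ⋃ k : ℕ, Ioc (a + ((k + 1 : ℕ) : ℝ) * E) (a + ((k + 2 : ℕ) : ℝ) * E) := by
    intro w hw
    have hw : a + E < w := hw
    rw [mem_iUnion]
    have hpos : 0 < (w - a - E) / E := by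
      apply div_pos _ hE; linarith
    obtain ⟨k, hk⟩ : ∃ k, ⌈(w - a - E) / E⌉₊ = k + 1 :=
      Nat.exists_eq_succ_of_ne_zero (Nat.ceil_pos.2 hpos).ne'
    have h1 := Nat.le_ceil ((w - a - E) / E)
    have h2 := Nat.ceil_lt_add_one hpos.le
    rw [hk] at h1 h2
    push_cast at h1 h2
    rw [div_le_iff₀ hE] at h1
    have h2' : (k : ℝ) < (w - a - E) / E := by linarith
    rw [lt_div_iff₀ hE] at h2'
    refine ⟨k, ?_, ?_⟩
    · push_cast; linarith
    · push_cast; linarith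
  refine (lintegral_mono_set hcov).trans ((lintegral_iUnion_le _ _).trans ?_)
  apply ENNReal.tsum_le_of_sum_range_le
  intro n
  have hcell : ∀ k : ℕ, ∫⁻ w in Ioc (a + ((k + 1 : ℕ) : ℝ) * E) (a + ((k + 2 : ℕ) : ℝ) * E), ENNReal.ofReal ((V (w + E) - V (w - E)) ^ 2)
      ≤ ENNReal.ofReal (3 * E * (d k ^ 2 + d (k+1) ^ 2 + d (k+2) ^ 2)) := by
    intro k
    have hv : volume (Ioc (a + ((k + 1 : ℕ) : ℝ) * E) (a + ((k + 2 : ℕ) : ℝ) * E)) = ENNReal.ofReal E := by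
      rw [Real.volume_Ioc]; congr 1; push_cast; ring
    have e : 3 * E * (d k ^ 2 + d (k+1) ^ 2 + d (k+2) ^ 2) = (3 * (d k ^ 2 + d (k+1) ^ 2 + d (k+2) ^ 2)) * E := by ring
    rw [e, ENNReal.ofReal_mul (by positivity), ← hv, ← setLIntegral_const]
    apply setLIntegral_mono measurable_const
    intro w hw
    apply ENNReal.ofReal_le_ofReal
    have hk0 : (0:ℝ) ≤ k := Nat.cast_nonneg k
    have hkE : (0:ℝ) ≤ k * E := by positivity
    obtain ⟨hw1, hw2⟩ := hw
    push_cast at hw1 hw2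
    have m1 : V (a + (k:ℝ) * E) ≤ V (w - E) := hV (mem_Ioi.2 (by positivity)) (mem_Ioi.2 (by linarith)) (by linarith)
    have m2 : V (w - E) ≤ V (w + E) := hV (mem_Ioi.2 (by linarith)) (mem_Ioi.2 (by linarith)) (by linarith)
    have m3 : V (w + E) ≤ V (a + ((k + 2 + 1 : ℕ):ℝ) * E) := hV (mem_Ioi.2 (by linarith)) (mem_Ioi.2 (by positivity)) (by push_cast; linarith)
    have es : V (a + ((k + 2 + 1 : ℕ):ℝ) * E) - V (a + (k:ℝ) * E) = d k + d (k+1) + d (k+2) := by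
      rw [hd]; ring
    have h1 : V (w + E) - V (w - E) ≤ d k + d (k+1) + d (k+2) := by linarith
    have h2 := pow_le_pow_left₀ (sub_nonneg.2 m2) h1 2
    nlinarith [sq_nonneg (d k - d (k+1)), sq_nonneg (d k - d (k+2)), sq_nonneg (d (k+1) - d (k+2))]
  refine (Finset.sum_le_sum (fun k _ => hcell k)).trans ?_
  rw [← ENNReal.ofReal_sum_of_nonneg (fun k _ => by positivity)]
  apply ENNReal.ofReal_le_ofReal
  rw [← Finset.mul_sum, Finset.sum_add_distrib, Finset.sum_add_distrib]
  have s1 : ∑ k ∈ Finset.range n, d k ^ 2 ≤ CM * E / a := hM' n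
  have s2 : ∑ k ∈ Finset.range n, d (k+1) ^ 2 ≤ CM * E / a := by
    refine le_trans ?_ (hM' (n+1)); rw [Finset.sum_range_succ' _ n]; linarith [sq_nonneg (d 0)]
  have s3 : ∑ k ∈ Finset.range n, d (k+2) ^ 2 ≤ CM * E / a := by
    refine le_trans ?_ (hM' (n+2)); rw [Finset.sum_range_succ' _ (n+1), Finset.sum_range_succ' _ n]
    linarith [sq_nonneg (d 0), sq_nonneg (d (0 + 1))]
  have := mul_le_mul_of_nonneg_left (add_le_add (add_le_add s1 s2) s3) (show 0 ≤ 3 * E by positivity)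
  refine this.trans (le_of_eq ?_)
  ring

lemma Dens.ae_Gm_mem (h : Dens γ) : ∀ᵐ t ∂(rhoM γ), Gm γ t ∈ Ioc (0:ℝ) 1 := by
  have : ∀ᵐ w ∂((rhoM γ).map (Gm γ)), w ∈ Ioc (0:ℝ) 1 := by
    rw [h.map_eq]; exact ae_restrict_mem measurableSet_Ioc
  exact ae_of_ae_map h.cont.measurable.aemeasurable this

lemma Dens.core (h : Dens γ) (V : ℝ → ℝ) (hVm : Measurable V) (hV : MonotoneOn V (Ioi 0)) (CM CG : ℝ)
    (hCM : 0 ≤ CM) (hCG : 0 ≤ CG)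
    (hG : ∀ s t, 0 < s → s ≤ t → (V t - V s) ^ 2 ≤ CG * (1 + log (t / s)))
    (hM : ∀ a E : ℝ, 0 < a → 0 < E → ∀ N : ℕ, ∑ i ∈ Finset.range N, (V (a + ((i + 1 : ℕ) : ℝ) * E) - V (a + (i : ℝ) * E)) ^ 2 ≤ CM * E / a) :
    ∫⁻ t, ENNReal.ofReal ((V (Gm γ t) - V t) ^ 2) ∂(rhoM γ) ≤
      ENNReal.ofReal ((384 * (31 * CM + 122 * CG) + 7 * CG) * ∫ s in Ioc 0 1, klFun (γ s)) := by
  obtain ⟨H, hH⟩ : ∃ H, H = ∫ s in Ioc 0 1, klFun (γ s) := ⟨_, rfl⟩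
  have hH0 : 0 ≤ H := hH ▸ h.H_nonneg
  rw [← hH]
  have hpt : ∀ t, 0 < t → 0 < Gm γ t → (V (Gm γ t) - V t) ^ 2 ≤ 3 * CG + CG * (Lpl γ t + Lm γ t) := by
    intro t ht hw
    have hlog4 : log 4 ≤ 2 := by
      rw [show (4:ℝ) = 2 ^ 2 by norm_num, Real.log_pow]
      have := Real.log_two_lt_d9
      norm_num; linarith
    have hl0 : 0 ≤ Lpl γ t := le_max_left _ _
    have hm0 : 0 ≤ Lm γ t := le_max_left _ _
    rcases le_total t (Gm γ t) with hle | hle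
    · have h1 := hG _ _ ht hle
      have h2 : log (Gm γ t / t) - log 4 ≤ Lpl γ t := le_max_right _ _
      have : CG * (1 + log (Gm γ t / t)) ≤ CG * (3 + (Lpl γ t + Lm γ t)) :=
        mul_le_mul_of_nonneg_left (by linarith) hCG
      linarith
    · have h1 := hG _ _ hw hle
      have h2 : log (t / Gm γ t) - log 4 ≤ Lm γ t := le_max_right _ _
      have : CG * (1 + log (t / Gm γ t)) ≤ CG * (3 + (Lpl γ t + Lm γ t)) :=
        mul_le_mul_of_nonneg_left (by linarith) hCG
      nlinarith
  obtain ⟨f, hf⟩ : ∃ f : ℝ → ℝ≥0∞, f = fun t => ENNReal.ofReal ((V (Gm γ t) - V t) ^ 2) := ⟨_, rfl⟩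
  obtain ⟨L, hL⟩ : ∃ L : ℝ → ℝ≥0∞, L = fun t => ENNReal.ofReal (CG * (Lpl γ t + Lm γ t)) := ⟨_, rfl⟩
  have hLm : Measurable L := by
    rw [hL]
    have := h.Lp_meas
    have := h.Lm_meas
    fun_prop
  have hLint : ∫⁻ t, L t ∂(rhoM γ) ≤ ENNReal.ofReal (7 * CG * H) := by
    have e : ∀ t, L t = ENNReal.ofReal CG * (ENNReal.ofReal (Lpl γ t) + ENNReal.ofReal (Lm γ t)) := by
      intro t
      rw [hL, ← ENNReal.ofReal_add (show 0 ≤ Lpl γ t from le_max_left _ _) (show 0 ≤ Lm γ t from le_max_left _ _), ← ENNReal.ofReal_mul hCG]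
    simp_rw [e]
    have m1 : Measurable fun t => ENNReal.ofReal (Lpl γ t) := h.Lp_meas.ennreal_ofReal
    have m2 : Measurable fun t => ENNReal.ofReal (Lm γ t) := h.Lm_meas.ennreal_ofReal
    have m3 : Measurable fun t => ENNReal.ofReal (Lpl γ t) + ENNReal.ofReal (Lm γ t) := m1.add m2
    rw [lintegral_const_mul _ m3, lintegral_add_left m1]
    have := add_le_add h.Lp_int h.Lm_int
    rw [← hH, ← ENNReal.ofReal_add (by positivity) (by positivity)] at this
    refine (mul_le_mul_right this _).trans ?_
    rw [← ENNReal.ofReal_mul hCG]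
    apply ENNReal.ofReal_le_ofReal
    nlinarith [mul_nonneg hCG hH0]
  have hsplit : ∫⁻ t, f t ∂(rhoM γ) ≤ ∫⁻ t, (f t - L t) ∂(rhoM γ) + ∫⁻ t, L t ∂(rhoM γ) := by
    rw [← lintegral_add_right _ hLm]
    exact lintegral_mono fun t => le_tsub_add
  have hblock : ∀ j : ℕ, ∫⁻ t in Gm γ ⁻¹' Ioc ((1/2:ℝ) ^ (j+1)) ((1/2:ℝ) ^ j), (f t - L t) ∂(rhoM γ) ≤
      ENNReal.ofReal ((31 * CM + 122 * CG) * ((1/2 : ℝ) ^ j * rhot (Sg γ (j - 1) / (1/2 : ℝ) ^ j))) := by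
    intro j
    obtain ⟨r, hr⟩ : ∃ r, r = (1/2:ℝ) ^ j := ⟨_, rfl⟩
    have hr0 : 0 < r := by rw [hr]; positivity
    have hr1 : (1/2:ℝ) ^ (j + 1) = r / 2 := by rw [pow_succ, hr]; ring
    have hrle : r ≤ 1 := hr ▸ half_pow_le_one j
    obtain ⟨E, hE⟩ : ∃ E, E = Sg γ (j - 1) := ⟨_, rfl⟩
    have hE0 : 0 ≤ E := hE ▸ Sg_nonneg _
    rw [hr1, ← hr, ← hE]
    have hmset : MeasurableSet (Gm γ ⁻¹' Ioc (r / 2) r) := h.cont.measurable measurableSet_Ioc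
    have hmu : rhoM γ (Gm γ ⁻¹' Ioc (r / 2) r) = ENNReal.ofReal (r / 2) := by
      rw [← Measure.map_apply h.cont.measurable measurableSet_Ioc, h.map_eq,
        Measure.restrict_apply measurableSet_Ioc, inter_eq_self_of_subset_left
          (Ioc_subset_Ioc (by positivity) hrle), Real.volume_Ioc]
      congr 1; ring
    rcases le_or_gt E (r / 8) with hgood | hbad
    · -- good block
      have hdist : ∀ᵐ t ∂((rhoM γ).restrict (Gm γ ⁻¹' Ioc (r / 2) r)), |Gm γ t - t| ≤ E := by
        rw [ae_restrict_iff' hmset]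
        filter_upwards [h.ae_mem] with t ht htr
        have htr : Gm γ t ∈ Ioc (r/2) r := htr
        rw [hE]
        apply h.abs_sub_le ht.1.le
        rcases Nat.eq_zero_or_pos j with hj | hj
        · rw [hj]; simpa using ht.2
        · obtain ⟨k, rfl⟩ : ∃ k, j = k + 1 := ⟨j - 1, by omega⟩
          simp only [Nat.add_sub_cancel] at hE ⊢
          have e2 : (1/2:ℝ) ^ k = 2 * r := by rw [hr, pow_succ]; ring
          by_contra hcon
          push Not at hcon
          have h1 := h.mono hcon.le
          have h2 := h.abs_sub_le (t := (1/2:ℝ)^k) (r := (1/2:ℝ)^k) (by positivity) le_rfl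
          rw [show (∫ s in Ioc 0 ((1/2:ℝ)^k), |γ s - 1|) = E from hE.symm] at h2
          rw [abs_le] at h2
          have := htr.2
          linarith [h2.1]
      rcases hE0.eq_or_lt with hEz | hEpos
      · have : ∫⁻ t in Gm γ ⁻¹' Ioc (r / 2) r, (f t - L t) ∂(rhoM γ) = 0 := by
          rw [lintegral_congr_ae (g := fun _ => 0)]
          · simp
          · filter_upwards [hdist] with t ht
            rw [← hEz] at ht
            have : Gm γ t = t := by
              have := abs_nonpos_iff.1 ht; linarith
            rw [hf]; simp [this]
        rw [this]; exact zero_le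
      have hstep1 : ∫⁻ t in Gm γ ⁻¹' Ioc (r / 2) r, (f t - L t) ∂(rhoM γ) ≤
          ∫⁻ t in Gm γ ⁻¹' Ioc (r / 2) r, ENNReal.ofReal ((V (Gm γ t + E) - V (Gm γ t - E)) ^ 2) ∂(rhoM γ) := by
        apply lintegral_mono_ae
        filter_upwards [hdist, ae_restrict_mem hmset] with t ht htr
        have htr : Gm γ t ∈ Ioc (r/2) r := htr
        have h1 := htr.1
        refine tsub_le_self.trans ?_
        rw [hf]
        apply ENNReal.ofReal_le_ofReal
        obtain ⟨ht1, ht2⟩ := abs_le.1 ht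
        have p1 : 0 < Gm γ t - E := by linarith
        have m1 : V (Gm γ t - E) ≤ V t := hV p1 (show 0 < t by linarith) (by linarith)
        have m2 : V t ≤ V (Gm γ t + E) := hV (show 0 < t by linarith) (mem_Ioi.2 (by linarith)) (by linarith)
        have m3 : V (Gm γ t - E) ≤ V (Gm γ t) := hV p1 (mem_Ioi.2 (by linarith)) (by linarith)
        have m4 : V (Gm γ t) ≤ V (Gm γ t + E) := hV (mem_Ioi.2 (by linarith)) (mem_Ioi.2 (by linarith)) (by linarith)
        apply sq_le_sq'
        · linarith
        · linarith
      refine hstep1.trans ?_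
      have hFm : Measurable fun w => ENNReal.ofReal ((V (w + E) - V (w - E)) ^ 2) := by fun_prop
      have hstep2 : ∫⁻ t in Gm γ ⁻¹' Ioc (r / 2) r, ENNReal.ofReal ((V (Gm γ t + E) - V (Gm γ t - E)) ^ 2) ∂(rhoM γ)
          = ∫⁻ w in Ioc (r/2) r, ENNReal.ofReal ((V (w + E) - V (w - E)) ^ 2) := by
        rw [← setLIntegral_map measurableSet_Ioc hFm h.cont.measurable, h.map_eq,
          Measure.restrict_restrict measurableSet_Ioc, inter_eq_self_of_subset_left
          (Ioc_subset_Ioc (by positivity) hrle)]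
      rw [hstep2]
      have ha : 0 < r / 2 - E := by linarith
      have hgb := good_block V hV CM (r / 2 - E) E ha hEpos (hM _ _ ha hEpos)
      have hsub : Ioc (r/2) r ⊆ Ioi (r / 2 - E + E) := by
        intro w hw; have := hw.1; show _ < w; linarith
      refine (lintegral_mono_set hsub).trans (hgb.trans ?_)
      apply ENNReal.ofReal_le_ofReal
      have hrt : r * (64/81 * (E / r) ^ 2) ≤ r * rhot (E / r) := by
        apply mul_le_mul_of_nonneg_left _ hr0.le
        unfold rhot
        rw [div_pow (E / r)]
        have hx : E / r ≤ 1/8 := by rw [div_le_iff₀ hr0]; linarith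
        have hx0 : 0 ≤ E / r := by positivity
        rw [le_div_iff₀ (by positivity)]
        have : (1 + E / r) ^ 2 ≤ 81/64 := by nlinarith
        nlinarith [sq_nonneg (E / r)]
      have h1 : 9 * CM * E ^ 2 / (r / 2 - E) ≤ 24 * CM * (E ^ 2 / r) := by
        rw [div_le_iff₀ ha]
        have : 24 * CM * (E ^ 2 / r) * (r / 2 - E) = 24 * CM * E ^ 2 * ((r / 2 - E) / r) := by ring
        rw [this]
        have h3 : 3 / 8 ≤ (r / 2 - E) / r := by rw [le_div_iff₀ hr0]; linarith
        have := mul_le_mul_of_nonneg_left h3 (show 0 ≤ 24 * CM * E ^ 2 by positivity)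
        linarith
      have h2 : r * (64/81 * (E / r) ^ 2) = 64/81 * (E ^ 2 / r) := by field_simp
      rw [h2] at hrt
      have h3 := mul_le_mul_of_nonneg_left hrt hCM
      have h4 : 0 ≤ CG * (r * rhot (E / r)) := mul_nonneg hCG (mul_nonneg hr0.le (rhot_nonneg _))
      have h5 : 0 ≤ CM * (E ^ 2 / r) := by positivity
      nlinarith
    · -- bad block
      have hstep1 : ∫⁻ t in Gm γ ⁻¹' Ioc (r / 2) r, (f t - L t) ∂(rhoM γ) ≤
          ∫⁻ t in Gm γ ⁻¹' Ioc (r / 2) r, ENNReal.ofReal (3 * CG) ∂(rhoM γ) := by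
        apply lintegral_mono_ae
        refine (ae_restrict_iff' hmset).2 ?_
        filter_upwards [h.ae_mem] with t ht htr
        have htr : Gm γ t ∈ Ioc (r/2) r := htr
        have hn : 0 ≤ CG * (Lpl γ t + Lm γ t) :=
          mul_nonneg hCG (add_nonneg (le_max_left _ _) (le_max_left _ _))
        rw [tsub_le_iff_right, hf, hL, ← ENNReal.ofReal_add (by positivity) hn]
        exact ENNReal.ofReal_le_ofReal (hpt t ht.1 (lt_trans (by positivity) htr.1))
      refine hstep1.trans ?_
      rw [setLIntegral_const, hmu, ← ENNReal.ofReal_mul (by positivity)]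
      apply ENNReal.ofReal_le_ofReal
      have hrt : r * (1/81) ≤ r * rhot (E / r) := by
        apply mul_le_mul_of_nonneg_left _ hr0.le
        unfold rhot
        have hx : 1/8 < E / r := by rw [lt_div_iff₀ hr0]; linarith
        have : 1/9 ≤ (E / r) / (1 + E / r) := by
          rw [le_div_iff₀ (by positivity)]; linarith
        nlinarith
      have h3 := mul_le_mul_of_nonneg_left hrt hCG
      have h4 : 0 ≤ CM * (r * rhot (E / r)) := mul_nonneg hCM (mul_nonneg hr0.le (rhot_nonneg _))
      nlinarith
  have hmain : ∫⁻ t, (f t - L t) ∂(rhoM γ) ≤ ENNReal.ofReal ((31 * CM + 122 * CG) * (384 * H)) := by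
    have hae : rhoM γ = (rhoM γ).restrict (Gm γ ⁻¹' Ioc 0 1) := by
      exact (Measure.restrict_eq_self_of_ae_mem (s := Gm γ ⁻¹' Ioc 0 1) h.ae_Gm_mem).symm
    rw [hae]
    rw [dyadic_cover, preimage_iUnion]
    refine (lintegral_iUnion_le _ _).trans ?_
    apply ENNReal.tsum_le_of_sum_range_le
    intro n
    refine (Finset.sum_le_sum (fun j _ => hblock j)).trans ?_
    rw [← ENNReal.ofReal_sum_of_nonneg (fun j _ => by
      have := rhot_nonneg (Sg γ (j - 1) / (1/2 : ℝ) ^ j)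
      positivity), ← Finset.mul_sum]
    apply ENNReal.ofReal_le_ofReal
    have := h.sum_rhot n
    rw [← hH] at this
    exact mul_le_mul_of_nonneg_left this (by positivity)
  rw [hf] at hsplit
  refine hsplit.trans ?_
  rw [← hf]
  refine (add_le_add hmain hLint).trans ?_
  rw [← ENNReal.ofReal_add (by positivity) (by positivity)]
  apply ENNReal.ofReal_le_ofReal
  linarith

end PartPH

section PartPI

open InformationTheory (klFun)

variable {γ : ℝ → ℝ}

noncomputable def Kc (lam C' : ℝ) : ℝ :=
  384 * (31 * (8 * lam) + 122 * (8 * C' + 2 * (1 + √(2 * lam)) ^ 2)) + 7 * (8 * C' + 2 * (1 + √(2 * lam)) ^ 2)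

lemma half_core (h : Dens γ) (μ : Measure ℝ) [IsProbabilityMeasure μ] (lam : ℝ) (hlam : 0 ≤ lam) (hP : Poinc μ lam)
    (hexp : ∀ s > (0:ℝ), Integrable (fun x => Real.exp (s * |x|)) μ) (C' : ℝ) (hC : 0 < C') (hL : CLSI μ C')
    (Q : ℝ → ℝ) (hQ : QuantLike μ Q) (hQm : Measurable Q) :
    ∫⁻ t, ENNReal.ofReal ((Q (min (Gm γ t) (1/2)) - Q (min t (1/2))) ^ 2) ∂(rhoM γ) ≤
      ENNReal.ofReal (Kc lam C' * ∫ s in Ioc 0 1, klFun (γ s)) := by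
  unfold Kc
  apply h.core (fun t => Q (min t (1/2))) (by fun_prop)
  · intro s hs t ht hst
    have hs : 0 < s := hs
    exact hQ.mono (lt_min hs (by norm_num)) (min_le_min_right _ hst) (lt_of_le_of_lt (min_le_right _ _) (by norm_num))
  · positivity
  · positivity
  · intro s t hs hst
    have hs' : 0 < min s (1/2) := lt_min hs (by norm_num)
    have := G_of μ lam hlam hP hexp C' hC hL Q hQ _ _ hs' (min_le_min_right (1/2) hst) (min_le_right _ _)
    refine this.trans ?_
    apply mul_le_mul_of_nonneg_left _ (by positivity)
    have ht : 0 < t := by linarith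
    have ht' : 0 < min t (1/2) := lt_min ht (by norm_num)
    have : min t (1/2) / min s (1/2) ≤ t / s := by
      rw [div_le_div_iff₀ hs' hs]
      rcases le_total s (1/2) with h1 | h1
      · rw [min_eq_left h1]; exact mul_le_mul_of_nonneg_right (min_le_left _ _) hs.le
      · rw [min_eq_right h1, min_eq_right (h1.trans hst)]; linarith
    have := Real.log_le_log (by positivity) this
    linarith
  · intro a E ha hE N
    rcases le_or_gt a (1/2) with h1 | h1
    · have := M_of_poincare μ lam hlam hP Q hQ a E ha (fun i => min (a + (i:ℝ) * E) (1/2)) (by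
        intro i j hij
        apply min_le_min_right
        have : (i:ℝ) ≤ j := by exact_mod_cast hij
        nlinarith) (by simp; linarith) N (min_le_right _ _) (by
        intro i _
        have : min (a + ((i+1 : ℕ):ℝ) * E) (1/2) ≤ min (a + (i:ℝ) * E) (1/2) + E := by
          rw [← min_add_add_right]
          apply min_le_min
          · push_cast; linarith
          · linarith
        show min (a + ((i+1 : ℕ):ℝ) * E) (1/2) - min (a + (i:ℝ) * E) (1/2) ≤ E
        linarith) hE.le
      exact this
    · have : ∀ i ∈ Finset.range N, (Q (min (a + ((i + 1 : ℕ):ℝ) * E) (1/2)) - Q (min (a + (i:ℝ) * E) (1/2))) ^ 2 = 0 := by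
        intro i _
        have e : ∀ j : ℕ, min (a + (j:ℝ) * E) (1/2) = 1/2 := by
          intro j; apply min_eq_right
          have : (0:ℝ) ≤ j * E := by positivity
          linarith
        rw [e, e]; simp
      rw [Finset.sum_congr rfl this]
      simp; positivity

/-! ### reflection -/

lemma Poinc.neg {μ : Measure ℝ} {lam : ℝ} (h : Poinc μ lam) : Poinc (μ.map Neg.neg) lam := by
  intro f hf ⟨K, hK⟩
  have h1 := h (fun x => f (-x)) (hf.comp contDiff_neg) ⟨K, by
    have := hK.comp (LipschitzWith.id.neg (α := ℝ))
    simpa [Function.comp_def] using this⟩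
  have me : MeasurableEmbedding (Neg.neg : ℝ → ℝ) := (MeasurableEquiv.neg ℝ).measurableEmbedding
  rw [me.integral_map, me.integral_map, me.integral_map]
  have e : ∀ x, deriv (fun x => f (-x)) x ^ 2 = deriv f (-x) ^ 2 := by
    intro x; rw [deriv_comp_neg]; ring
  simp_rw [e] at h1
  exact h1

lemma exp_neg' {μ : Measure ℝ} (h : ∀ s > (0:ℝ), Integrable (fun x => Real.exp (s * |x|)) μ) :
    ∀ s > (0:ℝ), Integrable (fun x => Real.exp (s * |x|)) (μ.map Neg.neg) := by
  intro s hs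
  have me : MeasurableEmbedding (Neg.neg : ℝ → ℝ) := (MeasurableEquiv.neg ℝ).measurableEmbedding
  rw [me.integrable_map_iff]
  simpa [Function.comp_def] using h s hs

lemma CLSI.neg {μ : Measure ℝ} {C : ℝ} (h : CLSI μ C) : CLSI (μ.map Neg.neg) C := by
  intro f hf hc ⟨K, hK⟩
  have h1 := h (fun x => f (-x)) (hf.comp contDiff_neg) (by
    have := hc.comp_linearMap (-LinearMap.id : ℝ →ₗ[ℝ] ℝ)
    simpa [Function.comp_def] using this) ⟨K, by
    have := hK.comp (LipschitzWith.id.neg (α := ℝ))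
    simpa [Function.comp_def] using this⟩
  have me : MeasurableEmbedding (Neg.neg : ℝ → ℝ) := (MeasurableEquiv.neg ℝ).measurableEmbedding
  have e : ∀ x, deriv (fun x => f (-x)) x ^ 2 = deriv f (-x) ^ 2 := by
    intro x; rw [deriv_comp_neg]; ring
  simp_rw [e] at h1
  unfold Ent at *
  rw [me.integral_map, me.integral_map, me.integrable_map_iff, me.lintegral_map]
  exact h1

lemma QuantLike.neg {μ : Measure ℝ} [IsProbabilityMeasure μ] {Q : ℝ → ℝ} (h : QuantLike μ Q) :
    QuantLike (μ.map Neg.neg) (fun t => - Q (1 - t)) := by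
  intro t ht
  obtain ⟨h1, h2⟩ := h (1 - t) ⟨by linarith [ht.2], by linarith [ht.1]⟩
  rw [map_measureReal_apply measurable_neg measurableSet_Iic, map_measureReal_apply measurable_neg measurableSet_Iio]
  have e1 : (Neg.neg : ℝ → ℝ) ⁻¹' Iic (-Q (1 - t)) = (Iio (Q (1 - t)))ᶜ := by ext; simp
  have e2 : (Neg.neg : ℝ → ℝ) ⁻¹' Iio (-Q (1 - t)) = (Iic (Q (1 - t)))ᶜ := by ext; simp
  rw [e1, e2, probReal_compl_eq_one_sub measurableSet_Iio, probReal_compl_eq_one_sub measurableSet_Iic]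
  constructor <;> linarith

lemma Dens.refl_kl (_h : Dens γ) : ∫ s in Ioc 0 1, klFun (γ (1 - s)) = ∫ s in Ioc 0 1, klFun (γ s) := by
  rw [← intervalIntegral.integral_of_le zero_le_one, ← intervalIntegral.integral_of_le zero_le_one,
    intervalIntegral.integral_comp_sub_left (fun s => klFun (γ s)) 1]
  simp

lemma Dens.refl (h : Dens γ) (h1 : γ 1 = 0) : Dens (fun t => γ (1 - t)) where
  meas := h.meas.comp (measurable_const.sub measurable_id)
  nonneg t := h.nonneg _
  supp t ht := by
    by_cases h0 : t = 0
    · rw [h0]; simpa using h1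
    · apply h.supp
      intro hh
      apply ht
      have := hh.1; have := hh.2
      exact ⟨lt_of_le_of_ne (by linarith) (Ne.symm h0), by linarith⟩
  int := h.int.comp_sub_left 1
  one := by rw [integral_sub_left_eq_self γ volume 1]; exact h.one
  kl := by
    have : IntervalIntegrable (fun t => klFun (γ t)) volume 0 1 :=
      (intervalIntegrable_iff_integrableOn_Ioc_of_le zero_le_one).2 h.kl
    have h2 := this.comp_sub_left 1
    simp only [sub_zero, sub_self] at h2
    exact (intervalIntegrable_iff_integrableOn_Ioc_of_le zero_le_one).1 h2.symm

lemma Dens.refl_Gm (h : Dens γ) (t : ℝ) : Gm (fun t => γ (1 - t)) t = 1 - Gm γ (1 - t) := by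
  unfold Gm
  have h1 : ∫ s in Iic t, γ (1 - s) = ∫ s in Ici (1 - t), γ s := by
    rw [← integral_indicator measurableSet_Iic, ← integral_indicator measurableSet_Ici,
      ← integral_sub_left_eq_self ((Ici (1 - t)).indicator γ) volume 1]
    congr 1
    ext s
    by_cases hs : s ≤ t
    · rw [indicator_of_mem (by exact hs), indicator_of_mem (by show 1 - t ≤ 1 - s; linarith)]
    · rw [indicator_of_notMem (by exact hs), indicator_of_notMem (by
        intro hh; have : 1 - t ≤ 1 - s := hh; exact hs (by linarith))]
  have h2 := integral_add_compl (s := Iic (1 - t)) measurableSet_Iic h.int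
  rw [h.one, compl_Iic] at h2
  rw [h1, integral_Ici_eq_integral_Ioi]
  linarith

lemma Dens.refl_lintegral (h : Dens γ) (F : ℝ → ℝ≥0∞) (hF : Measurable F) :
    ∫⁻ t, F t ∂(rhoM (fun t => γ (1 - t))) = ∫⁻ t, F (1 - t) ∂(rhoM γ) := by
  have hm := h.meas
  unfold rhoM
  rw [lintegral_withDensity_eq_lintegral_mul _ (by fun_prop) hF,
    lintegral_withDensity_eq_lintegral_mul _ (by fun_prop) (by fun_prop),
    ← lintegral_sub_left_eq_self _ (1:ℝ)]
  simp

lemma full_core (h : Dens γ) (h1 : γ 1 = 0) (μ : Measure ℝ) [IsProbabilityMeasure μ] (lam : ℝ) (hlam : 0 ≤ lam) (hP : Poinc μ lam)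
    (hexp : ∀ s > (0:ℝ), Integrable (fun x => Real.exp (s * |x|)) μ) (C' : ℝ) (hC : 0 < C') (hL : CLSI μ C')
    (Q : ℝ → ℝ) (hQ : QuantLike μ Q) (hQm : Measurable Q) :
    ∫⁻ t, ENNReal.ofReal ((Q (Gm γ t) - Q t) ^ 2) ∂(rhoM γ) ≤
      ENNReal.ofReal (4 * Kc lam C' * ∫ s in Ioc 0 1, klFun (γ s)) := by
  have hK : 0 ≤ Kc lam C' := by unfold Kc; positivity
  have hH := h.H_nonneg
  have hGm := h.cont.measurable
  have hl := half_core h μ lam hlam hP hexp C' hC hL Q hQ hQm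
  haveI : IsProbabilityMeasure (μ.map Neg.neg) := Measure.isProbabilityMeasure_map measurable_neg.aemeasurable
  have hr := half_core (h.refl h1) (μ.map Neg.neg) lam hlam hP.neg (exp_neg' hexp) C' hC hL.neg
    (fun t => - Q (1 - t)) hQ.neg (by fun_prop)
  rw [h.refl_kl, h.refl_lintegral _ (by
    have := (h.refl h1).cont.measurable
    fun_prop)] at hr
  have hr' : ∫⁻ t, ENNReal.ofReal ((Q (max (Gm γ t) (1/2)) - Q (max t (1/2))) ^ 2) ∂(rhoM γ) ≤
      ENNReal.ofReal (Kc lam C' * ∫ s in Ioc 0 1, klFun (γ s)) := by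
    refine le_trans (le_of_eq ?_) hr
    apply lintegral_congr
    intro t
    rw [h.refl_Gm]
    have e : ∀ x : ℝ, 1 - min (1 - x) (1/2) = max x (1/2) := by
      intro x
      rcases le_total x (1/2) with hx | hx
      · rw [max_eq_right hx, min_eq_right (by linarith)]; norm_num
      · rw [max_eq_left hx, min_eq_left (by linarith)]; ring
    have e2 : 1 - (1 - t) = t := by ring
    rw [e2, e, e]
    congr 1; ring
  have m1 : Measurable fun t => ENNReal.ofReal ((Q (min (Gm γ t) (1/2)) - Q (min t (1/2))) ^ 2) := by fun_prop
  have m2 : Measurable fun t => ENNReal.ofReal ((Q (max (Gm γ t) (1/2)) - Q (max t (1/2))) ^ 2) := by fun_prop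
  have m3 : Measurable fun t => ENNReal.ofReal ((Q (min (Gm γ t) (1/2)) - Q (min t (1/2))) ^ 2) +
      ENNReal.ofReal ((Q (max (Gm γ t) (1/2)) - Q (max t (1/2))) ^ 2) := m1.add m2
  have hb : ∫⁻ t, ENNReal.ofReal ((Q (Gm γ t) - Q t) ^ 2) ∂(rhoM γ) ≤
      ∫⁻ t, 2 * (ENNReal.ofReal ((Q (min (Gm γ t) (1/2)) - Q (min t (1/2))) ^ 2) +
      ENNReal.ofReal ((Q (max (Gm γ t) (1/2)) - Q (max t (1/2))) ^ 2)) ∂(rhoM γ) := by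
    apply lintegral_mono
    intro t
    show ENNReal.ofReal ((Q (Gm γ t) - Q t) ^ 2) ≤ 2 * (ENNReal.ofReal ((Q (min (Gm γ t) (1/2)) - Q (min t (1/2))) ^ 2) +
      ENNReal.ofReal ((Q (max (Gm γ t) (1/2)) - Q (max t (1/2))) ^ 2))
    rw [← ENNReal.ofReal_add (sq_nonneg _) (sq_nonneg _), show (2:ℝ≥0∞) = ENNReal.ofReal 2 by simp,
      ← ENNReal.ofReal_mul (by norm_num)]
    apply ENNReal.ofReal_le_ofReal
    have e : ∀ x, Q x = Q (min x (1/2)) + Q (max x (1/2)) - Q (1/2) := by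
      intro x
      rcases le_total x (1/2) with hx | hx
      · rw [max_eq_right hx, min_eq_left hx]; ring
      · rw [max_eq_left hx, min_eq_right hx]; ring
    rw [e (Gm γ t), e t]
    nlinarith [sq_nonneg ((Q (min (Gm γ t) (1/2)) - Q (min t (1/2))) - (Q (max (Gm γ t) (1/2)) - Q (max t (1/2))))]
  refine hb.trans ?_
  rw [lintegral_const_mul _ m3, lintegral_add_left m1]
  refine (mul_le_mul_right (add_le_add hl hr') _).trans ?_
  rw [← ENNReal.ofReal_add (by positivity) (by positivity), show (2:ℝ≥0∞) = ENNReal.ofReal 2 by simp,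
      ← ENNReal.ofReal_mul (by norm_num)]
  apply ENNReal.ofReal_le_ofReal
  linarith

end PartPI

open InformationTheory (klFun)

open scoped Classical in
noncomputable def Uq (μ : Measure ℝ) (t : ℝ) : ℝ := if t ∈ Ioo (0:ℝ) 1 then invCDF μ t else 0

lemma Uq_le_iff (μ : Measure ℝ) [IsProbabilityMeasure μ] {t : ℝ} (ht : t ∈ Ioo (0:ℝ) 1) (x : ℝ) :
    Uq μ t ≤ x ↔ t ≤ cdf μ x := by
  unfold Uq
  rw [if_pos ht]
  have eA : {y : ℝ | t ≤ (μ (Iic y)).toReal} = {y : ℝ | t ≤ cdf μ y} := by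
    ext y; rw [mem_ofPred_eq, mem_ofPred_eq, cdf_eq_real]; rfl
  unfold invCDF
  rw [eA]
  have hbd : BddBelow {y : ℝ | t ≤ cdf μ y} := by
    have h0 := (tendsto_cdf_atBot μ).eventually (gt_mem_nhds ht.1)
    obtain ⟨b, hb⟩ := h0.exists
    refine ⟨b, fun y hy => ?_⟩
    by_contra hh
    push Not at hh
    have h1 := monotone_cdf μ hh.le
    have : t ≤ cdf μ y := hy
    linarith
  have hne : {y : ℝ | t ≤ cdf μ y}.Nonempty := by
    have h0 := (tendsto_cdf_atTop μ).eventually (lt_mem_nhds ht.2)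
    obtain ⟨b, hb⟩ := h0.exists
    exact ⟨b, hb.le⟩
  constructor
  · intro hx
    refine le_trans ?_ (monotone_cdf μ hx)
    have hrc := (cdf μ).right_continuous (sInf {y : ℝ | t ≤ cdf μ y})
    have h2 : Tendsto (cdf μ) (𝓝[>] (sInf {y : ℝ | t ≤ cdf μ y})) (𝓝 (cdf μ (sInf {y : ℝ | t ≤ cdf μ y}))) :=
      hrc.tendsto.mono_left (nhdsWithin_mono _ Ioi_subset_Ici_self)
    apply ge_of_tendsto h2
    filter_upwards [self_mem_nhdsWithin] with y hy
    obtain ⟨z, hz, hzy⟩ := exists_lt_of_csInf_lt hne hy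
    exact le_trans hz (monotone_cdf μ hzy.le)
  · intro hx
    exact csInf_le hbd hx

lemma Uq_meas (μ : Measure ℝ) [IsProbabilityMeasure μ] : Measurable (Uq μ) := by
  apply measurable_of_Iic
  intro x
  have : Uq μ ⁻¹' Iic x = (Ioo 0 1 ∩ Iic (cdf μ x)) ∪ ((Ioo 0 1)ᶜ ∩ {_t | 0 ≤ x}) := by
    ext t
    by_cases ht : t ∈ Ioo (0:ℝ) 1
    · have := Uq_le_iff μ ht x
      simp only [mem_preimage, mem_Iic, mem_union, mem_inter_iff, mem_compl_iff, ht, not_true, false_and, or_false, true_and]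
      exact this
    · simp only [mem_preimage, mem_Iic, mem_union, mem_inter_iff, mem_compl_iff, ht, not_false_eq_true, false_and, false_or, true_and]
      unfold Uq; rw [if_neg ht]; rfl
  rw [this]
  apply MeasurableSet.union (measurableSet_Ioo.inter measurableSet_Iic)
  exact measurableSet_Ioo.compl.inter (MeasurableSet.const _)

lemma Uq_map (μ : Measure ℝ) [IsProbabilityMeasure μ] : (volume.restrict (Ioo 0 1)).map (Uq μ) = μ := by
  apply Eq.symm
  apply Measure.ext_of_Iic
  intro x
  rw [Measure.map_apply (Uq_meas μ) measurableSet_Iic, Measure.restrict_apply (Uq_meas μ measurableSet_Iic)]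
  have e : Uq μ ⁻¹' Iic x ∩ Ioo 0 1 = Iic (cdf μ x) ∩ Ioo 0 1 := by
    ext t
    constructor
    · rintro ⟨h1, h2⟩; exact ⟨(Uq_le_iff μ h2 x).1 h1, h2⟩
    · rintro ⟨h1, h2⟩; exact ⟨(Uq_le_iff μ h2 x).2 h1, h2⟩
  rw [e]
  have h0 := cdf_nonneg μ x
  have h1 := cdf_le_one μ x
  have e2 : volume (Iic (cdf μ x) ∩ Ioo 0 1) = ENNReal.ofReal (cdf μ x) := by
    apply le_antisymm
    · refine (measure_mono (t := Ioc 0 (cdf μ x)) ?_).trans ?_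
      · rintro t ⟨ht, h2⟩; exact ⟨h2.1, ht⟩
      · rw [Real.volume_Ioc]; simp
    · have : Ioo 0 (cdf μ x) ⊆ Iic (cdf μ x) ∩ Ioo 0 1 := by
        intro t ht; exact ⟨ht.2.le, ht.1, lt_of_lt_of_le ht.2 h1⟩
      refine le_trans ?_ (measure_mono this)
      rw [Real.volume_Ioo]; simp
  rw [e2, cdf_eq_real, ofReal_measureReal]

lemma Uq_quant (μ : Measure ℝ) [IsProbabilityMeasure μ] : QuantLike μ (Uq μ) := by
  intro t ht
  constructor
  · rw [← cdf_eq_real]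
    exact (Uq_le_iff μ ht _).1 le_rfl
  · have h1 : μ (Iio (Uq μ t)) ≤ ENNReal.ofReal t := by
      nth_rw 1 [← Uq_map μ]
      rw [Measure.map_apply (Uq_meas μ) measurableSet_Iio, Measure.restrict_apply (Uq_meas μ measurableSet_Iio)]
      refine (measure_mono (t := Ioo 0 t) ?_).trans ?_
      · rintro s ⟨hs, hs2⟩
        refine ⟨hs2.1, ?_⟩
        by_contra hcon
        push Not at hcon
        have hs : Uq μ s < Uq μ t := hs
        have h3 := (Uq_le_iff μ hs2 _).1 (le_refl (Uq μ s))
        have h4 := (Uq_le_iff μ ht (Uq μ s)).2 (hcon.trans h3)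
        linarith
      · rw [Real.volume_Ioo]; simp
    exact ENNReal.toReal_le_of_le_ofReal ht.1.le h1

lemma T2_of (μ : Measure ℝ) [IsProbabilityMeasure μ] (lam : ℝ) (hlam : 0 ≤ lam) (hP : Poinc μ lam)
    (hexp : ∀ s > (0:ℝ), Integrable (fun x => Real.exp (s * |x|)) μ) (C' : ℝ) (hC : 0 < C') (hL : CLSI μ C')
    (ν : Measure ℝ) [IsProbabilityMeasure ν] :
    transportCost (fun t => t ^ 2) μ ν ≤ ENNReal.ofReal (4 * Kc lam C') * relEnt ν μ := by
  have hK : 0 < Kc lam C' := by unfold Kc; positivity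
  by_cases hfin : ν ≪ μ ∧ Integrable (fun x => Real.log ((ν.rnDeriv μ x).toReal)) ν
  swap
  · unfold relEnt
    rw [if_neg hfin, ENNReal.mul_top]
    · exact le_top
    · simpa using hK
  have hac := hfin.1
  have hkl : relEnt ν μ = ∫⁻ x, ENNReal.ofReal (klFun (ν.rnDeriv μ x).toReal) ∂μ := by
    rw [← InformationTheory.klDiv_eq_lintegral_klFun_of_ac hac, InformationTheory.klDiv_of_ac_of_integrable hac hfin.2]
    unfold relEnt
    rw [if_pos hfin]
    simp [llr]
  have hklfin : relEnt ν μ ≠ ⊤ := by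
    unfold relEnt; rw [if_pos hfin]; exact ENNReal.ofReal_ne_top
  have hU := Uq_meas μ
  have hg : Measurable fun x => (ν.rnDeriv μ x).toReal := (Measure.measurable_rnDeriv ν μ).ennreal_toReal
  -- transfer
  have htr : ∀ F : ℝ → ℝ≥0∞, Measurable F → ∫⁻ t in Ioo 0 1, F (Uq μ t) = ∫⁻ x, F x ∂μ := by
    intro F hF
    nth_rw 2 [← Uq_map μ]
    rw [lintegral_map hF hU]
  obtain ⟨γ, hγ⟩ : ∃ γ : ℝ → ℝ, γ = (Ioo (0:ℝ) 1).indicator (fun t => (ν.rnDeriv μ (Uq μ t)).toReal) := ⟨_, rfl⟩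
  have hγm : Measurable γ := by rw [hγ]; exact (hg.comp hU).indicator measurableSet_Ioo
  have hγ0 : ∀ t, 0 ≤ γ t := by
    intro t; rw [hγ]; exact indicator_nonneg (fun _ _ => ENNReal.toReal_nonneg) t
  have hγin : ∀ t ∈ Ioo (0:ℝ) 1, γ t = (ν.rnDeriv μ (Uq μ t)).toReal := by
    intro t ht; rw [hγ, indicator_of_mem ht]
  have hγout : ∀ t, t ∉ Ioo (0:ℝ) 1 → γ t = 0 := by
    intro t ht; rw [hγ, indicator_of_notMem ht]
  have hset : ∀ A : Set ℝ, MeasurableSet A → ∫⁻ t in Uq μ ⁻¹' A, ENNReal.ofReal (γ t) = ν A := by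
    intro A hA
    have e1 : ∫⁻ t in Uq μ ⁻¹' A, ENNReal.ofReal (γ t) =
        ∫⁻ t in Ioo 0 1, A.indicator (fun x => ENNReal.ofReal ((ν.rnDeriv μ x).toReal)) (Uq μ t) := by
      rw [← lintegral_indicator (hU hA), ← lintegral_indicator measurableSet_Ioo]
      congr 1
      ext t
      by_cases ht : t ∈ Ioo (0:ℝ) 1
      · rw [indicator_of_mem ht]
        by_cases hA' : Uq μ t ∈ A
        · rw [indicator_of_mem (by exact hA'), indicator_of_mem hA', hγin t ht]
        · rw [indicator_of_notMem (by exact hA'), indicator_of_notMem hA']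
      · rw [indicator_of_notMem ht]
        apply indicator_apply_eq_zero.2
        intro _; rw [hγout t ht]; simp
    rw [e1, htr _ (hg.ennreal_ofReal.indicator hA), lintegral_indicator hA]
    have e2 : ∫⁻ x in A, ENNReal.ofReal ((ν.rnDeriv μ x).toReal) ∂μ = ∫⁻ x in A, ν.rnDeriv μ x ∂μ := by
      apply lintegral_congr_ae
      apply ae_restrict_of_ae
      filter_upwards [Measure.rnDeriv_ne_top ν μ] with x hx
      exact ENNReal.ofReal_toReal hx
    rw [e2, Measure.setLIntegral_rnDeriv hac]
  have hone : ∫⁻ t, ENNReal.ofReal (γ t) = 1 := by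
    have := hset univ MeasurableSet.univ
    simpa using this
  have hklγ : ∫⁻ t in Ioc 0 1, ENNReal.ofReal (klFun (γ t)) = relEnt ν μ := by
    rw [hkl, ← htr (fun x => ENNReal.ofReal (klFun (ν.rnDeriv μ x).toReal))
      ((InformationTheory.measurable_klFun.comp hg).ennreal_ofReal), Measure.restrict_congr_set Ioo_ae_eq_Ioc.symm]
    apply setLIntegral_congr_fun measurableSet_Ioo
    intro t ht
    simp only [hγin t ht]
  have hklm : Measurable fun t => klFun (γ t) := InformationTheory.measurable_klFun.comp hγm
  have hkl0 : ∀ t, 0 ≤ klFun (γ t) := fun t => InformationTheory.klFun_nonneg (hγ0 t)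
  have hintegr : Integrable γ := by
    refine ⟨hγm.aestronglyMeasurable, ?_⟩
    rw [hasFiniteIntegral_iff_ofReal (Eventually.of_forall hγ0), hone]; simp
  have hD : Dens γ := {
    meas := hγm
    nonneg := hγ0
    supp := fun t ht => hγout t (fun hh => ht ⟨hh.1, hh.2.le⟩)
    int := hintegr
    one := by
      rw [integral_eq_lintegral_of_nonneg_ae (Eventually.of_forall hγ0) hγm.aestronglyMeasurable, hone]; simp
    kl := by
      refine ⟨hklm.aestronglyMeasurable, ?_⟩
      rw [hasFiniteIntegral_iff_ofReal (Eventually.of_forall hkl0), hklγ]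
      exact lt_top_iff_ne_top.2 hklfin }
  have hHeq : ENNReal.ofReal (∫ s in Ioc 0 1, klFun (γ s)) = relEnt ν μ := by
    rw [ofReal_integral_eq_lintegral_ofReal hD.kl (Eventually.of_forall hkl0), hklγ]
  have hcore := full_core hD (hγout 1 (by simp)) μ lam hlam hP hexp C' hC hL (Uq μ) (Uq_quant μ) hU
  rw [ENNReal.ofReal_mul (by positivity), hHeq] at hcore
  refine le_trans ?_ hcore
  have hGm := hD.cont.measurable
  have hpair : Measurable fun t => (Uq μ (Gm γ t), Uq μ t) := by fun_prop
  unfold transportCost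
  refine iInf_le_of_le ((rhoM γ).map (fun t => (Uq μ (Gm γ t), Uq μ t))) (iInf_le_of_le ?_ (iInf_le_of_le ?_ ?_))
  · rw [Measure.map_map measurable_fst hpair]
    change (rhoM γ).map (Uq μ ∘ Gm γ) = μ
    rw [← Measure.map_map hU hGm, hD.map_eq, Measure.restrict_congr_set Ioo_ae_eq_Ioc.symm, Uq_map]
  · rw [Measure.map_map measurable_snd hpair]
    change (rhoM γ).map (Uq μ) = ν
    ext A hA
    rw [Measure.map_apply hU hA]
    unfold rhoM
    rw [withDensity_apply _ (hU hA), hset A hA]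
  · rw [lintegral_map (by fun_prop) hpair]
    simp only [sq_abs]
    exact le_rfl

theorem talagrand_iff_poincare_and_convex_logSobolev
    (μ : Measure ℝ) [IsProbabilityMeasure μ] :
    (∃ C : ℝ, ∀ ν : Measure ℝ, IsProbabilityMeasure ν →
      transportCost (fun t => t ^ 2) μ ν ≤ ENNReal.ofReal C * relEnt ν μ)
    ↔
    ((∃ lam : ℝ, ∀ f : ℝ → ℝ, ContDiff ℝ (⊤ : ℕ∞) f → (∃ K : ℝ≥0, LipschitzWith K f) →
        (∫ x, f x ^ 2 ∂μ) - (∫ x, f x ∂μ) ^ 2 ≤ lam * ∫ x, (deriv f x) ^ 2 ∂μ)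
      ∧
      ((∀ s > (0:ℝ), Integrable (fun x => Real.exp (s * |x|)) μ) ∧
        ∃ C' > (0:ℝ), ∀ φ : ℝ → ℝ, ContDiff ℝ (⊤ : ℕ∞) φ → ConvexOn ℝ Set.univ φ →
          (∃ K : ℝ≥0, LipschitzWith K φ) →
          Ent μ (fun x => Real.exp (φ x)) ≤
            ENNReal.ofReal C' *
              ∫⁻ x, ENNReal.ofReal ((deriv φ x) ^ 2 * Real.exp (φ x)) ∂μ)) := by
  constructor
  · rintro ⟨C0, hC0⟩
    have hC : 0 < max C0 1 := lt_max_of_lt_right one_pos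
    have hT : ∀ ν : Measure ℝ, IsProbabilityMeasure ν →
        transportCost (fun t => t ^ 2) μ ν ≤ ENNReal.ofReal (max C0 1) * relEnt ν μ := by
      intro ν hν
      refine (hC0 ν hν).trans ?_
      gcongr
      exact le_max_left _ _
    refine ⟨⟨max C0 1, ?_⟩, ?_, max C0 1, hC, ?_⟩
    · rintro f hf ⟨K, hK⟩
      exact poincare_of_T2 μ _ hC hT f hf K hK
    · intro s hs
      exact exp_integrable_of_T2 μ _ hC hT s hs
    · rintro φ hφ hc ⟨K, hK⟩
      exact convex_LSI_of_T2 μ _ hC hT φ hφ hc K hK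
  · rintro ⟨⟨lam, hP⟩, hexp, C', hC', hL⟩
    refine ⟨4 * Kc (max lam 0) C', fun ν hν => ?_⟩
    apply T2_of μ (max lam 0) (le_max_right _ _) _ hexp C' hC' hL ν
    intro f hf hK
    refine (hP f hf hK).trans ?_
    apply mul_le_mul_of_nonneg_right (le_max_left _ _)
    exact integral_nonneg fun x => sq_nonneg _
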